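/- Let n ≥ 2 and let K₁, …, K_n be nonempty compact convex sets in ℝⁿ. Then MV(K₁, K₂, K₃, …, K_n)² ≥ MV(K₁, K₁, K₃, …, K_n) · MV(K₂, K₂, K₃, …, K_n). (This is the Alexandrov–Fenchel type inequality of Theorem 7.1, stated via the identification of top intersection degrees in the convex-set algebra with mixed volumes.) -/

import Mathlib

open scoped Pointwise
open MeasureTheory Finset

/-- Lebesgue volume of a subset of ℝⁿ, as a real number. -/
noncomputable def vol {n : ℕ} (A : Set (Fin n → ℝ)) : ℝ := (volume A).toReal

/-- The mixed volume of `n` convex bodies in ℝⁿ, defined by the inclusion–exclusion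
formula `MV(K₁, …, K_n) = Σ_{j=1}^{n} (−1)^{n−j} Σ_{1 ≤ i₁ < ⋯ < i_j ≤ n}
vol(K_{i₁} + ⋯ + K_{i_j})`, where `+` is the Minkowski sum. -/
noncomputable def MV (n : ℕ) (K : Fin n → Set (Fin n → ℝ)) : ℝ :=
  ∑ j ∈ Finset.Icc 1 n, (-1 : ℝ) ^ (n - j) *
    ∑ S ∈ Finset.univ.powersetCard j, vol (∑ i ∈ S, K i)

set_option linter.all false



namespace AF

section Alg
variable {J : Type} [Fintype J] [DecidableEq J]

/-- directional derivative -/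
noncomputable def D (v : J → ℝ) : Derivation ℝ (MvPolynomial J ℝ) (MvPolynomial J ℝ) :=
  MvPolynomial.mkDerivation ℝ (fun j => MvPolynomial.C (v j))

@[simp] lemma D_X (v : J → ℝ) (j : J) : D v (MvPolynomial.X j) = MvPolynomial.C (v j) := by
  simp [D]

@[simp] lemma D_C (v : J → ℝ) (a : ℝ) : D v (MvPolynomial.C a) = 0 := by
  simp [D]

lemma D_add (v w : J → ℝ) (f) : D (v + w) f = D v f + D w f := by
  have : D (v + w) = D v + D w := by
    apply MvPolynomial.derivation_ext; intro j; simp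
  rw [this]; rfl

lemma D_smul (a : ℝ) (v : J → ℝ) (f) : D (a • v) f = a • D v f := by
  have : D (a • v) = a • D v := by
    apply MvPolynomial.derivation_ext; intro j; simp [MvPolynomial.smul_eq_C_mul]
  rw [this]; rfl

lemma D_comm (v w : J → ℝ) (f) : D v (D w f) = D w (D v f) := by
  have : ⁅D v, D w⁆ = 0 := by
    apply MvPolynomial.derivation_ext; intro j; simp [Derivation.commutator_apply]
  have h2 := congrArg (fun d => d f) this
  simp only [Derivation.commutator_apply, Derivation.zero_apply] at h2
  exact sub_eq_zero.mp h2

lemma D_eq_sum (v : J → ℝ) (f) : D v f = ∑ j, v j • D (Pi.single j 1) f := by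
  induction f using MvPolynomial.induction_on with
  | C a => simp
  | add p q hp hq => simp [hp, hq, Finset.sum_add_distrib]
  | mul_X p k hp =>
    simp only [Derivation.leibniz, hp, D_X, smul_eq_mul, smul_add, Finset.sum_add_distrib]
    congr 1
    · rw [Finset.sum_eq_single k]
      · simp [MvPolynomial.smul_eq_C_mul, mul_comm]
      · intro b _ hb; simp [Pi.single_apply, hb.symm]
      · simp
    · rw [Finset.mul_sum]; congr 1; ext1 j; simp

lemma D_single (j : J) (f) : D (Pi.single j 1) f = MvPolynomial.pderiv j f := by
  have : D (Pi.single j 1) = MvPolynomial.pderiv j := by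
    apply MvPolynomial.derivation_ext; intro k
    simp [MvPolynomial.pderiv_X, Pi.single_apply]
  rw [this]

/-- iterated derivative -/
noncomputable def DL (l : List (J → ℝ)) (f : MvPolynomial J ℝ) : MvPolynomial J ℝ :=
  l.foldr (fun v g => D v g) f

@[simp] lemma DL_nil (f : MvPolynomial J ℝ) : DL [] f = f := rfl
@[simp] lemma DL_cons (v : J → ℝ) (l) (f : MvPolynomial J ℝ) : DL (v :: l) f = D v (DL l f) := rfl

lemma DL_D (v : J → ℝ) (l) (f : MvPolynomial J ℝ) : DL l (D v f) = D v (DL l f) := by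
  induction l with
  | nil => rfl
  | cons w l ih => rw [DL_cons, ih, D_comm]; rfl

lemma DL_smul (l) (a : ℝ) (f : MvPolynomial J ℝ) : DL l (a • f) = a • DL l f := by
  induction l with
  | nil => rfl
  | cons w l ih => simp [ih]

lemma DL_sum (l) {ι : Type} (s : Finset ι) (f : ι → MvPolynomial J ℝ) :
    DL l (∑ i ∈ s, f i) = ∑ i ∈ s, DL l (f i) := by
  induction l with
  | nil => rfl
  | cons w l ih => simp [ih]

lemma DL_perm {l l' : List (J → ℝ)} (h : l.Perm l') (f : MvPolynomial J ℝ) : DL l f = DL l' f := by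
  induction h with
  | nil => rfl
  | cons x _ ih => simp [ih]
  | swap x y l => simp [D_comm]
  | trans _ _ h1 h2 => rw [h1, h2]

/-- mixed value -/
noncomputable def M (l : List (J → ℝ)) (f : MvPolynomial J ℝ) : ℝ := MvPolynomial.eval 0 (DL l f)

lemma M_perm {l l' : List (J → ℝ)} (h : l.Perm l') (f : MvPolynomial J ℝ) : M l f = M l' f := by
  rw [M, DL_perm h, M]

lemma M_swap (a b : J → ℝ) (l) (f : MvPolynomial J ℝ) : M (a :: b :: l) f = M (b :: a :: l) f :=
  M_perm (List.Perm.swap _ _ _) f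

lemma M_add (v w : J → ℝ) (l) (f : MvPolynomial J ℝ) :
    M ((v + w) :: l) f = M (v :: l) f + M (w :: l) f := by
  simp [M, D_add]

lemma M_smul (a : ℝ) (v : J → ℝ) (l) (f : MvPolynomial J ℝ) :
    M ((a • v) :: l) f = a * M (v :: l) f := by
  simp [M, D_smul]

lemma M_sum (v : J → ℝ) (l) (f : MvPolynomial J ℝ) :
    M (v :: l) f = ∑ i, v i * M (Pi.single i 1 :: l) f := by
  simp only [M, DL_cons]
  rw [D_eq_sum v]; simp

/-- linear substitution `h ↦ h - c h_i` -/
noncomputable def sub (i : J) (c : J → ℝ) : MvPolynomial J ℝ →ₐ[ℝ] MvPolynomial J ℝ :=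
  MvPolynomial.aeval (fun j => MvPolynomial.X j - MvPolynomial.C (c j) * MvPolynomial.X i)

def Lm (i : J) (c : J → ℝ) (h : J → ℝ) : J → ℝ := fun j => h j - c j * h i

lemma D_sub (i : J) (c : J → ℝ) (v : J → ℝ) (f) :
    D v (sub i c f) = sub i c (D (Lm i c v) f) := by
  induction f using MvPolynomial.induction_on with
  | C a => 
    have : sub i c (MvPolynomial.C a) = MvPolynomial.C a := (sub i c).commutes a
    rw [this]; simp
  | add p q hp hq => simp [hp, hq]
  | mul_X p j hp =>
    have h1 : sub i c (MvPolynomial.X j) = MvPolynomial.X j - MvPolynomial.C (c j) * MvPolynomial.X i := by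
      simp [sub]
    have h2 : ∀ a, sub i c (MvPolynomial.C a) = MvPolynomial.C a := fun a => (sub i c).commutes a
    simp only [map_mul, Derivation.leibniz, smul_eq_mul, hp, h1, h2, D_X, D_C, map_add, map_sub, Lm]
    ring

lemma eval_sub (i : J) (c : J → ℝ) (h : J → ℝ) (f) :
    MvPolynomial.eval h (sub i c f) = MvPolynomial.eval (Lm i c h) f := by
  induction f using MvPolynomial.induction_on with
  | C a => 
    have : sub i c (MvPolynomial.C a) = MvPolynomial.C a := (sub i c).commutes a
    rw [this]; simp
  | add p q hp hq => simp [hp, hq]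
  | mul_X p j hp =>
    have h1 : sub i c (MvPolynomial.X j) = MvPolynomial.X j - MvPolynomial.C (c j) * MvPolynomial.X i := by
      simp [sub]
    simp [hp, h1, Lm]

lemma M_sub (i : J) (c : J → ℝ) (l) (f) :
    M l (sub i c f) = M (l.map (Lm i c)) f := by
  have : DL l (sub i c f) = sub i c (DL (l.map (Lm i c)) f) := by
    induction l with
    | nil => rfl
    | cons v l ih => simp [ih, D_sub]
  rw [M, this, eval_sub, M]
  congr 2
  ext; simp [Lm]

lemma sub_homog (i : J) (c : J → ℝ) {n : ℕ} {f : MvPolynomial J ℝ} (hf : f.IsHomogeneous n) :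
    (sub i c f).IsHomogeneous n := by
  have := hf.aeval (n := 1) (fun j => MvPolynomial.X j - MvPolynomial.C (c j) * MvPolynomial.X i) (by
    intro j
    apply MvPolynomial.IsHomogeneous.sub (MvPolynomial.isHomogeneous_X _ _)
    simpa using (MvPolynomial.isHomogeneous_C J (c j)).mul (MvPolynomial.isHomogeneous_X ℝ i))
  simpa [sub] using this

lemma eq_of_open {U : Set (J → ℝ)} (hU : IsOpen U) (hne : U.Nonempty) {f g : MvPolynomial J ℝ}
    (h : ∀ x ∈ U, MvPolynomial.eval x f = MvPolynomial.eval x g) : f = g := by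
  obtain ⟨x, hx⟩ := hne
  obtain ⟨ε, hε, hb⟩ := Metric.isOpen_iff.mp hU x hx
  apply MvPolynomial.funext_set (fun j => Metric.ball (x j) ε)
  · intro y hy
    have h1 : (Metric.ball (x y) ε).Infinite := by
      rw [Real.ball_eq_Ioo]; exact Set.Ioo_infinite (by linarith)
    exact h1 hy
  · intro y hy
    apply h; apply hb
    rw [Metric.mem_ball, dist_pi_lt_iff hε]
    intro j; exact hy j trivial

lemma continuous_eval (f : MvPolynomial J ℝ) : Continuous (fun x : J → ℝ => MvPolynomial.eval x f) :=
  MvPolynomial.continuous_eval f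

lemma hasDerivAt_eval (f : MvPolynomial J ℝ) (h v : J → ℝ) (t : ℝ) :
    HasDerivAt (fun t : ℝ => MvPolynomial.eval (h + t • v) f)
      (MvPolynomial.eval (h + t • v) (D v f)) t := by
  induction f using MvPolynomial.induction_on with
  | C a => simpa using hasDerivAt_const t a
  | add p q hp hq =>
    have := hp.add hq
    simp only [map_add]
    exact this
  | mul_X p j hp =>
    have h1 : HasDerivAt (fun t : ℝ => h j + t * v j) (v j) t := by
      simpa using ((hasDerivAt_id t).mul_const (v j)).const_add (h j)
    have := hp.mul h1
    have e : (fun t : ℝ => MvPolynomial.eval (h + t • v) (p * MvPolynomial.X j)) =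
      ((fun t => (MvPolynomial.eval (h + t • v)) p) * fun t => h j + t * v j) := by
      funext s; simp
    have e2 : MvPolynomial.eval (h + t • v) (D v (p * MvPolynomial.X j)) =
      MvPolynomial.eval (h + t • v) (D v p) * (h j + t * v j) +
        MvPolynomial.eval (h + t • v) p * v j := by
      simp only [Derivation.leibniz, D_X, smul_eq_mul, map_add, map_mul, MvPolynomial.eval_C,
        MvPolynomial.eval_X, Pi.add_apply, Pi.smul_apply]
      ring
    rw [e, e2]
    exact this

end Alg
end AF


namespace AF

section Pol
variable {J : Type} [Fintype J] [DecidableEq J]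

lemma alt_monomial {n : ℕ} (a : Fin n →₀ ℕ) (ha : a.degree = n) :
    ∑ S : Finset (Fin n), (-1 : ℝ) ^ (n - S.card) *
      MvPolynomial.eval (fun i => if i ∈ S then (1:ℝ) else 0) (MvPolynomial.monomial a 1) =
    if a = ∑ i, Finsupp.single i 1 then 1 else 0 := by
  have h1 : ∏ i : Fin n, ((1:ℝ) + -(0:ℝ) ^ (a i)) = if a = ∑ i, Finsupp.single i 1 then 1 else 0 := by
    split_ifs with h
    · rw [h]
      apply Finset.prod_eq_one
      intro i _
      simp [Finsupp.finset_sum_apply, Finsupp.single_apply]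
    · by_contra hne
      apply h
      have h2 : ∀ i, a i ≠ 0 := by
        intro i hi
        apply hne
        apply Finset.prod_eq_zero (Finset.mem_univ i)
        simp [hi]
      have h3 : ∑ i, a i = ∑ i : Fin n, 1 := by
        rw [Finsupp.degree_eq_sum] at ha
        simpa using ha
      have h4 := (Finset.sum_eq_sum_iff_of_le (s := univ) (f := fun _ : Fin n => 1) (g := a)
        (fun i _ => Nat.one_le_iff_ne_zero.mpr (h2 i))).mp h3.symm
      ext i
      simp [Finsupp.finset_sum_apply, Finsupp.single_apply, ← h4 i (Finset.mem_univ i)]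
  rw [← h1, Fintype.prod_add]
  apply Finset.sum_congr rfl
  intro S _
  rw [MvPolynomial.eval_monomial, Finsupp.prod_fintype _ _ (by simp)]
  simp only [Finset.prod_const_one, one_mul, Finset.prod_neg]
  rw [Finset.card_compl, Fintype.card_fin]
  congr 1
  rw [← Finset.prod_mul_prod_compl S]
  rw [Finset.prod_eq_one (s := S)]
  · rw [one_mul]
    apply Finset.prod_congr rfl
    intro i hi
    rw [if_neg (by simpa using hi)]
  · intro i hi; simp [hi]

lemma coeff_DL_single {n : ℕ} (l : List (Fin n)) (hl : l.Nodup) (g : MvPolynomial (Fin n) ℝ)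
    (m : Fin n →₀ ℕ) (hm : ∀ i ∈ l, m i = 0) :
    MvPolynomial.coeff m (DL (l.map (fun i => Pi.single i (1:ℝ))) g) =
      MvPolynomial.coeff (m + (l.map (fun i => Finsupp.single i 1)).sum) g := by
  induction l generalizing m with
  | nil => simp
  | cons i l ih =>
    rw [List.nodup_cons] at hl
    simp only [List.map_cons, DL_cons, D_single, MvPolynomial.coeff_pderiv, List.sum_cons]
    rw [ih hl.2, hm i (by simp)]
    · simp [add_assoc]
    · intro k hk
      have : k ≠ i := by rintro rfl; exact hl.1 hk
      simp [hm k (by simp [hk]), Finsupp.single_apply, this.symm]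

lemma polarize_fin {n : ℕ} (φ : MvPolynomial (Fin n) ℝ) (hφ : φ.IsHomogeneous n) :
    ∑ S : Finset (Fin n), (-1 : ℝ) ^ (n - S.card) *
      MvPolynomial.eval (fun i => if i ∈ S then (1:ℝ) else 0) φ =
    MvPolynomial.coeff (∑ i, Finsupp.single i 1) φ := by
  conv_lhs => rw [φ.as_sum]
  simp only [map_sum, Finset.mul_sum]
  rw [Finset.sum_comm]
  have : ∀ a ∈ φ.support, ∑ S : Finset (Fin n), (-1 : ℝ) ^ (n - S.card) *
      MvPolynomial.eval (fun i => if i ∈ S then (1:ℝ) else 0) (MvPolynomial.monomial a (φ.coeff a)) =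
    φ.coeff a * if a = ∑ i, Finsupp.single i 1 then 1 else 0 := by
    intro a ha
    have hd : a.degree = n := by
      have := hφ (MvPolynomial.mem_support_iff.mp ha)
      rw [Finsupp.degree_eq_weight_one]; exact this
    rw [← alt_monomial a hd, Finset.mul_sum]
    apply Finset.sum_congr rfl
    intro S _
    have : MvPolynomial.monomial a (φ.coeff a) = MvPolynomial.C (φ.coeff a) * MvPolynomial.monomial a 1 := by
      rw [MvPolynomial.C_mul_monomial, mul_one]
    rw [this]; simp only [map_mul, MvPolynomial.eval_C]; ring
  rw [Finset.sum_congr rfl this]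
  simp only [mul_ite, mul_one, mul_zero, Finset.sum_ite_eq']
  split_ifs with h
  · rfl
  · rw [MvPolynomial.notMem_support_iff] at h; exact h.symm

lemma polarize {n : ℕ} (f : MvPolynomial J ℝ) (hf : f.IsHomogeneous n) (h : Fin n → J → ℝ) :
    ∑ S : Finset (Fin n), (-1 : ℝ) ^ (n - S.card) * MvPolynomial.eval (∑ i ∈ S, h i) f =
      M (List.ofFn h) f := by
  set F : MvPolynomial J ℝ →ₐ[ℝ] MvPolynomial (Fin n) ℝ :=
    MvPolynomial.aeval (fun j => ∑ i, MvPolynomial.C (h i j) * MvPolynomial.X i) with hF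
  have FX : ∀ j, F (MvPolynomial.X j) = ∑ i, MvPolynomial.C (h i j) * MvPolynomial.X i := by
    intro j; simp [hF]
  have FC : ∀ a, F (MvPolynomial.C a) = MvPolynomial.C a := fun a => F.commutes a
  have hom : (F f).IsHomogeneous n := by
    have := hf.aeval (n := 1) (fun j => ∑ i, MvPolynomial.C (h i j) * MvPolynomial.X i) (by
      intro j
      apply MvPolynomial.IsHomogeneous.sum
      intro i _
      simpa using (MvPolynomial.isHomogeneous_C (Fin n) (h i j)).mul (MvPolynomial.isHomogeneous_X ℝ i))
    simpa [F] using this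
  have ev : ∀ t : Fin n → ℝ, ∀ g, MvPolynomial.eval t (F g) = MvPolynomial.eval (∑ i, t i • h i) g := by
    intro t g
    induction g using MvPolynomial.induction_on with
    | C a => rw [FC]; simp
    | add p q hp hq => simp [hp, hq]
    | mul_X p j hp =>
      simp only [map_mul, hp, FX, map_sum, MvPolynomial.eval_C, MvPolynomial.eval_X]
      congr 1
      simp [Finset.sum_apply, mul_comm]
  have der : ∀ i g, D (Pi.single i 1) (F g) = F (D (h i) g) := by
    intro i g
    induction g using MvPolynomial.induction_on with
    | C a => rw [FC]; simp
    | add p q hp hq => simp [hp, hq]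
    | mul_X p j hp =>
      have : D (Pi.single i 1) (F (MvPolynomial.X j)) = MvPolynomial.C (h i j) := by
        rw [FX]
        simp [Pi.single_apply]
      simp only [map_mul, Derivation.leibniz, hp, this, smul_eq_mul, map_add, D_X, FC]
  have derL : ∀ l : List (Fin n), DL (l.map (fun i => Pi.single i (1:ℝ))) (F f) = F (DL (l.map h) f) := by
    intro l
    induction l with
    | nil => rfl
    | cons i l ih => simp [ih, der]
  have h1 := polarize_fin (F f) hom
  have h2 : ∀ S : Finset (Fin n), MvPolynomial.eval (fun i => if i ∈ S then (1:ℝ) else 0) (F f) =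
      MvPolynomial.eval (∑ i ∈ S, h i) f := by
    intro S
    rw [ev]
    congr 2
    simp [Finset.sum_ite_mem]
  simp only [h2] at h1
  rw [h1]
  have h3 := coeff_DL_single (List.finRange n) (List.nodup_finRange n) (F f) 0 (by simp)
  rw [zero_add, derL] at h3
  have h4 : ((List.finRange n).map (fun i => Finsupp.single i 1)).sum = ∑ i : Fin n, Finsupp.single i 1 := by
    rw [← List.ofFn_eq_map, List.sum_ofFn]
  rw [h4] at h3
  rw [← h3, M, ← List.ofFn_eq_map]
  have h5 : MvPolynomial.eval (0 : Fin n → ℝ) (F (DL (List.ofFn h) f)) = MvPolynomial.eval 0 (DL (List.ofFn h) f) := by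
    rw [ev]; simp
  rw [← h5]
  have : (MvPolynomial.eval (0 : Fin n → ℝ)) = MvPolynomial.constantCoeff := by
    rw [MvPolynomial.eval_zero]
  rw [this, MvPolynomial.constantCoeff_eq]

end Pol
end AF


namespace AF

section LinAlg
variable {ι : Type} [Fintype ι] [DecidableEq ι]

lemma perron_id (A : ι → ι → ℝ) (hs : ∀ i j, A i j = A j i) (h p : ι → ℝ)
    (hh : ∀ i, 0 < h i) (hp : ∀ i, ∑ j, A i j * h j = p i * h i) (g : ι → ℝ) :
    ∑ i, p i * g i ^ 2 - ∑ i, g i * ∑ j, A i j * g j =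
      (1/2) * ∑ i, ∑ j, A i j * (h i * h j) * (g i / h i - g j / h j) ^ 2 := by
  have e1 : ∑ i, ∑ j, A i j * h j / h i * g i ^ 2 = ∑ i, p i * g i ^ 2 := by
    apply Finset.sum_congr rfl; intro i _
    rw [← Finset.sum_mul, ← Finset.sum_div, hp]
    have := (hh i).ne'
    field_simp
  have e2 : ∑ i, ∑ j, A i j * h i / h j * g j ^ 2 = ∑ i, p i * g i ^ 2 := by
    rw [← e1, Finset.sum_comm]
    apply Finset.sum_congr rfl; intro i _
    apply Finset.sum_congr rfl; intro j _
    rw [hs]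
  have e3 : ∑ i, g i * ∑ j, A i j * g j = ∑ i, ∑ j, A i j * g i * g j := by
    apply Finset.sum_congr rfl; intro i _
    rw [Finset.mul_sum]
    apply Finset.sum_congr rfl; intro j _
    ring
  have e4 : ∑ i, ∑ j, A i j * (h i * h j) * (g i / h i - g j / h j) ^ 2 =
     ∑ i, ∑ j, (A i j * h j / h i * g i ^ 2) + ∑ i, ∑ j, (A i j * h i / h j * g j ^ 2)
      - 2 * ∑ i, ∑ j, A i j * g i * g j := by
    rw [← Finset.sum_add_distrib, Finset.mul_sum, ← Finset.sum_sub_distrib]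
    apply Finset.sum_congr rfl; intro i _
    rw [← Finset.sum_add_distrib, Finset.mul_sum, ← Finset.sum_sub_distrib]
    apply Finset.sum_congr rfl; intro j _
    have := (hh i).ne'
    have := (hh j).ne'
    field_simp
    ring
  rw [e4, e1, e2, e3]; ring

lemma bochner (A : ι → ι → ℝ) (hs : ∀ i j, A i j = A j i) (h p : ι → ℝ)
    (hh : ∀ i, 0 < h i) (hp0 : ∀ i, 0 < p i) (hp : ∀ i, ∑ j, A i j * h j = p i * h i)
    (hA : ∀ i j, i ≠ j → 0 ≤ A i j)
    (hconn : ∀ T : Set ι, T.Nonempty → Tᶜ.Nonempty → ∃ i ∈ T, ∃ j ∈ Tᶜ, 0 < A i j)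
    (hB : ∀ g : ι → ℝ, ∑ i, g i * ∑ j, A i j * g j ≤ ∑ i, (∑ j, A i j * g j) ^ 2 / p i)
    (x : ι → ℝ) (hx : ∑ i, p i * h i * x i = 0) :
    ∑ i, x i * ∑ j, A i j * x j ≤ 0 := by
  set N : Matrix ι ι ℝ := Matrix.of fun i j => A i j / (√(p i) * √(p j)) with hN
  have hsq : ∀ i, 0 < √(p i) := fun i => Real.sqrt_pos.mpr (hp0 i)
  have hsq2 : ∀ i, √(p i) * √(p i) = p i := fun i => Real.mul_self_sqrt (hp0 i).le
  have hH : N.IsHermitian := by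
    ext i j; simp [hN, hs i j, mul_comm]
  -- key eigenvector property
  have key : ∀ k, 0 < hH.eigenvalues k → ∃ c : ℝ, ∀ i, hH.eigenvectorBasis k i = c * (√(p i) * h i) := by
    intro k hk
    set lam := hH.eigenvalues k
    set e : ι → ℝ := fun i => hH.eigenvectorBasis k i with he
    have hev : ∀ i, ∑ j, N i j * e j = lam * e i := by
      intro i
      have := congrFun (hH.mulVec_eigenvectorBasis k) i
      simpa [Matrix.mulVec, dotProduct] using this
    set g : ι → ℝ := fun i => e i / √(p i) with hg
    have hMg : ∀ i, ∑ j, A i j * g j = lam * (p i * g i) := by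
      intro i
      have h1 : ∑ j, A i j * g j = √(p i) * ∑ j, N i j * e j := by
        rw [Finset.mul_sum]
        apply Finset.sum_congr rfl; intro j _
        have := (hsq i).ne'
        have := (hsq j).ne'
        simp only [hN, hg, Matrix.of_apply]
        field_simp
      have h2 : p i * g i = √(p i) * e i := by
        have h3 := hsq2 i
        have := (hsq i).ne'
        have h4 : g i * √(p i) = e i := by simp only [hg]; field_simp
        rw [← h4]; nth_rewrite 1 [← h3]; ring
      rw [h1, hev, h2]; ring
    have hnorm : ∑ i, p i * g i ^ 2 = 1 := by
      have h1 : ‖hH.eigenvectorBasis k‖ = 1 := hH.eigenvectorBasis.orthonormal.1 k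
      have h2 : ‖hH.eigenvectorBasis k‖ ^ 2 = ∑ i, e i ^ 2 := by
        rw [EuclideanSpace.norm_sq_eq]; simp [he]
      rw [h1] at h2
      rw [show (1:ℝ) = 1 ^ 2 by norm_num, h2]
      apply Finset.sum_congr rfl; intro i _
      rw [← hsq2 i, hg]
      have := (hsq i).ne'
      field_simp
    have q1 : ∑ i, g i * ∑ j, A i j * g j = lam := by
      have : ∀ i, g i * ∑ j, A i j * g j = lam * (p i * g i ^ 2) := by
        intro i; rw [hMg]; ring
      simp only [this]; rw [← Finset.mul_sum, hnorm, mul_one]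
    have q2 : ∑ i, (∑ j, A i j * g j) ^ 2 / p i = lam ^ 2 := by
      have : ∀ i, (∑ j, A i j * g j) ^ 2 / p i = lam ^ 2 * (p i * g i ^ 2) := by
        intro i; rw [hMg]; have := (hp0 i).ne'; field_simp
      simp only [this]; rw [← Finset.mul_sum, hnorm, mul_one]
    have q3 := hB g
    rw [q1, q2] at q3
    have hl1 : 1 ≤ lam := by nlinarith
    have q4 := perron_id A hs h p hh hp g
    rw [hnorm, q1] at q4
    have nn : ∀ i j, 0 ≤ A i j * (h i * h j) * (g i / h i - g j / h j) ^ 2 := by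
      intro i j
      by_cases hij : i = j
      · subst hij; simp
      · have := hA i j hij; have := hh i; have := hh j; positivity
    have q5 : ∑ i, ∑ j, A i j * (h i * h j) * (g i / h i - g j / h j) ^ 2 = 0 := by
      have : 0 ≤ ∑ i, ∑ j, A i j * (h i * h j) * (g i / h i - g j / h j) ^ 2 :=
        Finset.sum_nonneg fun i _ => Finset.sum_nonneg fun j _ => nn i j
      linarith
    have q6 : ∀ i j, A i j * (h i * h j) * (g i / h i - g j / h j) ^ 2 = 0 := by
      intro i j
      have a1 := (Finset.sum_eq_zero_iff_of_nonneg (fun i _ => Finset.sum_nonneg fun j _ => nn i j)).mp q5 i (Finset.mem_univ i)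
      exact (Finset.sum_eq_zero_iff_of_nonneg (fun j _ => nn i j)).mp a1 j (Finset.mem_univ j)
    have q7 : ∀ i, g i / h i = g k / h k := by
      by_contra hcon
      push Not at hcon
      obtain ⟨i0, hi0⟩ := hcon
      obtain ⟨i, hi, j, hj, hij⟩ := hconn {i | g i / h i = g k / h k} ⟨k, rfl⟩ ⟨i0, hi0⟩
      have := q6 i j
      have hne : g i / h i - g j / h j ≠ 0 := by
        intro h0; apply hj
        show g j / h j = _
        rw [← (show g i / h i = g k / h k from hi)]; linarith
      have := hh i; have := hh j
      have : 0 < A i j * (h i * h j) * (g i / h i - g j / h j) ^ 2 := by positivity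
      linarith
    refine ⟨g k / h k, fun i => ?_⟩
    rw [← q7 i]
    show e i = _
    have := (hh i).ne'; have := (hsq i).ne'
    simp only [hg]
    field_simp
  -- expand
  set y : EuclideanSpace ℝ ι := WithLp.toLp 2 (fun i => √(p i) * x i) with hy
  set Ny : EuclideanSpace ℝ ι := WithLp.toLp 2 (N.mulVec (fun i => √(p i) * x i)) with hNy
  have f1 : ∑ i, x i * ∑ j, A i j * x j = inner ℝ y Ny := by
    simp only [PiLp.inner_apply, hy, hNy, Matrix.mulVec, dotProduct]
    apply Finset.sum_congr rfl; intro i _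
    simp only [RCLike.inner_apply, conj_trivial]
    rw [Finset.mul_sum, Finset.sum_mul]
    apply Finset.sum_congr rfl; intro j _
    have := (hsq i).ne'
    have := (hsq j).ne'
    simp only [hN, Matrix.of_apply]
    field_simp
  rw [f1, ← hH.eigenvectorBasis.sum_inner_mul_inner]
  apply Finset.sum_nonpos
  intro k _
  have f2 : inner ℝ (hH.eigenvectorBasis k) Ny = hH.eigenvalues k * inner ℝ y (hH.eigenvectorBasis k) := by
    have hev : ∀ i, ∑ j, N i j * hH.eigenvectorBasis k j = hH.eigenvalues k * hH.eigenvectorBasis k i := by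
      intro i
      have := congrFun (hH.mulVec_eigenvectorBasis k) i
      simpa [Matrix.mulVec, dotProduct] using this
    simp only [PiLp.inner_apply, hy, hNy, Matrix.mulVec, dotProduct]
    simp only [RCLike.inner_apply, conj_trivial]
    rw [Finset.mul_sum]
    simp only [Finset.sum_mul]
    rw [Finset.sum_comm]
    apply Finset.sum_congr rfl; intro i _
    rw [← mul_assoc, ← hev, Finset.sum_mul]
    apply Finset.sum_congr rfl; intro j _
    have : N j i = N i j := by simp [hN, hs i j, mul_comm]
    rw [this]; ring
  rw [f2]
  by_cases hk : 0 < hH.eigenvalues k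
  · obtain ⟨c, hc⟩ := key k hk
    have : inner ℝ y (hH.eigenvectorBasis k) = 0 := by
      simp only [PiLp.inner_apply, hy, RCLike.inner_apply, conj_trivial, hc]
      have : ∀ i, c * (√(p i) * h i) * (√(p i) * x i) = c * (p i * h i * x i) := by
        intro i; nth_rewrite 3 [← hsq2 i]; ring
      simp only [this]
      rw [← Finset.mul_sum, hx, mul_zero]
    rw [this]; simp
  · push Not at hk
    nlinarith [sq_nonneg (inner ℝ y (hH.eigenvectorBasis k))]

end LinAlg
end AF


namespace AF

section BM

lemma bm1_compact {X Y Z : Set ℝ} (hX : IsCompact X) (hY : IsCompact Y) (hXn : X.Nonempty)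
    (hYn : Y.Nonempty) (hZ : X + Y ⊆ Z) : volume X + volume Y ≤ volume Z := by
  obtain ⟨a, ha⟩ := hX.exists_isGreatest hXn
  obtain ⟨b, hb⟩ := hY.exists_isLeast hYn
  have h1 : ((· + b) '' X) ∪ ((a + ·) '' Y) ⊆ Z := by
    rintro z (⟨x, hx, rfl⟩ | ⟨y, hy, rfl⟩)
    · exact hZ (Set.add_mem_add hx hb.1)
    · exact hZ (Set.add_mem_add ha.1 hy)
  refine le_trans ?_ (measure_mono h1)
  rw [measure_union₀]
  · apply le_of_eq; congr 1
    · simp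
    · simp
  · exact (hY.image (by fun_prop)).measurableSet.nullMeasurableSet
  · apply measure_mono_null (t := {a + b})
    · rintro z ⟨⟨x, hx, rfl⟩, ⟨y, hy, hxy⟩⟩
      have := ha.2 hx
      have := hb.2 hy
      simp only at hxy
      simp; linarith
    · simp

lemma bm1 {X Y Z : Set ℝ} (hX : MeasurableSet X) (hY : MeasurableSet Y) (hXn : X.Nonempty)
    (hYn : Y.Nonempty) (hZ : X + Y ⊆ Z) : volume X + volume Y ≤ volume Z := by
  obtain ⟨x, hx⟩ := hXn
  obtain ⟨y, hy⟩ := hYn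
  rw [hX.measure_eq_iSup_isCompact, hY.measure_eq_iSup_isCompact]
  have key : ∀ K ⊆ X, IsCompact K → ∀ L ⊆ Y, IsCompact L → volume K + volume L ≤ volume Z := by
    intro K hK hKc L hL hLc
    refine le_trans ?_ (bm1_compact (X := insert x K) (Y := insert y L) (hKc.insert x) (hLc.insert y)
      ⟨x, by simp⟩ ⟨y, by simp⟩ ?_)
    · gcongr <;> simp
    · refine le_trans ?_ hZ
      apply Set.add_subset_add
      · exact Set.insert_subset hx hK
      · exact Set.insert_subset hy hL
  simp only [ENNReal.iSup_add, ENNReal.add_iSup, iSup_le_iff]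
  have h0 : ∀ K ⊆ X, IsCompact K → volume K ≤ volume Z := fun K hK hKc => by
    simpa using key K hK hKc ∅ (by simp) isCompact_empty
  have h0' : ∀ L ⊆ Y, IsCompact L → volume L ≤ volume Z := fun L hL hLc => by
    simpa using key ∅ (by simp) isCompact_empty L hL hLc
  intro L K
  by_cases h1 : K ⊆ X <;> by_cases h2 : IsCompact K <;> by_cases h3 : L ⊆ Y <;>
    by_cases h4 : IsCompact L <;> simp [h1, h2, h3, h4]
  · exact key K h1 h2 L h3 h4
  · exact h0 K h1 h2
  · exact h0 K h1 h2
  · exact h0 K h1 h2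
  · exact h0' L h3 h4
  · exact h0' L h3 h4
  · exact h0' L h3 h4

lemma bm2_aux {A : Set (ℝ × ℝ)} (hA : IsCompact A) (hv : 0 < volume A) :
    ∃ m : ℝ, 0 < m ∧ (∀ x, volume (Prod.mk x ⁻¹' A) ≤ ENNReal.ofReal m) ∧
      (∀ s < 1, ∃ x, s * m < (volume (Prod.mk x ⁻¹' A)).toReal) := by
  obtain ⟨R, hR⟩ := hA.isBounded.subset_closedBall 0
  have hb : ∀ x, volume (Prod.mk x ⁻¹' A) ≤ volume (Metric.closedBall (0:ℝ) R) := by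
    intro x
    apply measure_mono
    intro y hy
    have := hR hy
    simp [Prod.norm_def] at this ⊢
    exact this.2
  have hlt : volume (Metric.closedBall (0:ℝ) R) < ⊤ := measure_closedBall_lt_top
  have hbr : BddAbove (Set.range fun x => (volume (Prod.mk x ⁻¹' A)).toReal) := by
    refine ⟨(volume (Metric.closedBall (0:ℝ) R)).toReal, ?_⟩
    rintro _ ⟨x, rfl⟩
    exact ENNReal.toReal_mono hlt.ne (hb x)
  have hle : ∀ x, (volume (Prod.mk x ⁻¹' A)).toReal ≤ ⨆ x, (volume (Prod.mk x ⁻¹' A)).toReal :=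
    fun x => le_ciSup hbr x
  have hpos : 0 < ⨆ x, (volume (Prod.mk x ⁻¹' A)).toReal := by
    by_contra hcon
    have h0 : ∀ x, volume (Prod.mk x ⁻¹' A) = 0 := by
      intro x
      have h1 : (volume (Prod.mk x ⁻¹' A)).toReal = 0 :=
        le_antisymm ((hle x).trans (not_lt.mp hcon)) ENNReal.toReal_nonneg
      exact ((ENNReal.toReal_eq_zero_iff _).mp h1).resolve_right ((hb x).trans_lt hlt).ne
    rw [Measure.volume_eq_prod, Measure.prod_apply hA.measurableSet] at hv
    simp [h0] at hv
  refine ⟨_, hpos, ?_, ?_⟩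
  · intro x
    rw [ENNReal.le_ofReal_iff_toReal_le ((hb x).trans_lt hlt).ne hpos.le]
    exact hle x
  · intro s hs
    apply exists_lt_of_lt_ciSup
    nlinarith

lemma bm2_prod {A B : Set (ℝ × ℝ)} (hA : IsCompact A) (hB : IsCompact B)
    (hvA : 0 < volume A) (hvB : 0 < volume B) :
    (volume A).toReal + (volume B).toReal + 2 * √((volume A).toReal * (volume B).toReal) ≤
      (volume (A + B)).toReal := by
  obtain ⟨m, hm, hm1, hm2⟩ := bm2_aux hA hvA
  obtain ⟨k, hk, hk1, hk2⟩ := bm2_aux hB hvB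
  have hAB := hA.add hB
  have mA := measurable_measure_prodMk_left (ν := (volume : Measure ℝ)) hA.measurableSet
  have mB := measurable_measure_prodMk_left (ν := (volume : Measure ℝ)) hB.measurableSet
  have mAB := measurable_measure_prodMk_left (ν := (volume : Measure ℝ)) hAB.measurableSet
  -- layer cake
  have lay : ∀ (E : Set (ℝ × ℝ)) (r : ℝ), 0 < r → IsCompact E →
      volume E / ENNReal.ofReal r =
        ∫⁻ s in Set.Ioi 0, volume {x : ℝ | s < (volume (Prod.mk x ⁻¹' E)).toReal / r} := by
    intro E r hr hE
    have mE := measurable_measure_prodMk_left (ν := (volume : Measure ℝ)) hE.measurableSet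
    rw [← lintegral_eq_lintegral_meas_lt]
    · rw [Measure.volume_eq_prod, Measure.prod_apply hE.measurableSet, div_eq_mul_inv, mul_comm,
        ← lintegral_const_mul _ mE]
      apply lintegral_congr
      intro x
      rw [ENNReal.ofReal_div_of_pos hr, ENNReal.ofReal_toReal, div_eq_mul_inv, mul_comm]
      have : volume (Prod.mk x ⁻¹' E) < ⊤ := by
        obtain ⟨R, hR⟩ := hE.isBounded.subset_closedBall 0
        refine lt_of_le_of_lt (measure_mono (t := Metric.closedBall (0:ℝ) R) ?_) measure_closedBall_lt_top
        intro y hy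
        have := hR hy
        simp [Prod.norm_def] at this ⊢
        exact this.2
      exact this.ne
    · exact Filter.Eventually.of_forall fun x => by
        show 0 ≤ _
        positivity
    · exact (mE.ennreal_toReal.div_const r).aemeasurable
  have fin : ∀ E : Set (ℝ × ℝ), IsCompact E → ∀ x, volume (Prod.mk x ⁻¹' E) ≠ ⊤ := by
    intro E hE x
    obtain ⟨R, hR⟩ := hE.isBounded.subset_closedBall 0
    refine (lt_of_le_of_lt (measure_mono (t := Metric.closedBall (0:ℝ) R) ?_) measure_closedBall_lt_top).ne
    intro y hy
    have := hR hy
    simp [Prod.norm_def] at this ⊢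
    exact this.2
  have main : volume A / ENNReal.ofReal m + volume B / ENNReal.ofReal k ≤
      volume (A + B) / ENNReal.ofReal (m + k) := by
    rw [lay A m hm hA, lay B k hk hB, lay (A + B) (m + k) (by linarith) hAB]
    rw [← lintegral_add_left']
    · apply setLIntegral_mono_ae' measurableSet_Ioi
      refine Filter.Eventually.of_forall fun s hs => ?_
      have hs : 0 < s := hs
      by_cases h1 : s < 1
      · apply bm1
        · exact measurableSet_lt measurable_const (mA.ennreal_toReal.div_const m)
        · exact measurableSet_lt measurable_const (mB.ennreal_toReal.div_const k)
        · obtain ⟨x, hx⟩ := hm2 s h1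
          exact ⟨x, by simpa [lt_div_iff₀ hm] using hx⟩
        · obtain ⟨x, hx⟩ := hk2 s h1
          exact ⟨x, by simpa [lt_div_iff₀ hk] using hx⟩
        · rintro _ ⟨x, hx, y, hy, rfl⟩
          simp only [Set.mem_setOf_eq] at hx hy ⊢
          rw [lt_div_iff₀ (by linarith)] at hx hy ⊢
          have p1 : 0 < (volume (Prod.mk x ⁻¹' A)).toReal := by nlinarith
          have p2 : 0 < (volume (Prod.mk y ⁻¹' B)).toReal := by nlinarith
          have key : volume (Prod.mk x ⁻¹' A) + volume (Prod.mk y ⁻¹' B) ≤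
              volume (Prod.mk (x + y) ⁻¹' (A + B)) := by
            apply bm1
            · exact measurable_prodMk_left hA.measurableSet
            · exact measurable_prodMk_left hB.measurableSet
            · rw [Set.nonempty_iff_ne_empty]; intro h; rw [h] at p1; simp at p1
            · rw [Set.nonempty_iff_ne_empty]; intro h; rw [h] at p2; simp at p2
            · rintro _ ⟨a, ha, b, hb, rfl⟩
              exact ⟨(x, a), ha, (y, b), hb, rfl⟩
          have := ENNReal.toReal_mono (fin _ hAB _) key
          rw [ENNReal.toReal_add (fin _ hA _) (fin _ hB _)] at this
          nlinarith
      · have e1 : {x : ℝ | s < (volume (Prod.mk x ⁻¹' A)).toReal / m} = ∅ := by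
          ext x
          simp only [Set.mem_setOf_eq, Set.mem_empty_iff_false, iff_false, not_lt]
          have := (ENNReal.le_ofReal_iff_toReal_le (fin _ hA x) hm.le).mp (hm1 x)
          rw [div_le_iff₀ hm]; nlinarith
        have e2 : {x : ℝ | s < (volume (Prod.mk x ⁻¹' B)).toReal / k} = ∅ := by
          ext x
          simp only [Set.mem_setOf_eq, Set.mem_empty_iff_false, iff_false, not_lt]
          have := (ENNReal.le_ofReal_iff_toReal_le (fin _ hB x) hk.le).mp (hk1 x)
          rw [div_le_iff₀ hk]; nlinarith
        rw [e1, e2]; simp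
    · apply AEMeasurable.restrict
      apply Measurable.aemeasurable
      apply Antitone.measurable
      intro s t hst
      apply measure_mono
      intro x hx
      exact lt_of_le_of_lt hst hx
  have hAt := hA.measure_lt_top (μ := volume)
  have hBt := hB.measure_lt_top (μ := volume)
  have hABt := hAB.measure_lt_top (μ := volume)
  have hfin : volume (A + B) / ENNReal.ofReal (m + k) ≠ ⊤ :=
    ENNReal.div_ne_top hABt.ne (by simp; linarith)
  have r := ENNReal.toReal_mono hfin main
  rw [ENNReal.toReal_add (ENNReal.div_ne_top hAt.ne (by simp; linarith))
    (ENNReal.div_ne_top hBt.ne (by simp; linarith))] at r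
  simp only [ENNReal.toReal_div] at r
  rw [ENNReal.toReal_ofReal hm.le, ENNReal.toReal_ofReal hk.le, ENNReal.toReal_ofReal (by linarith)] at r
  set a := (volume A).toReal
  set b := (volume B).toReal
  have ha : 0 ≤ a := ENNReal.toReal_nonneg
  have hb : 0 ≤ b := ENNReal.toReal_nonneg
  rw [le_div_iff₀ (by linarith)] at r
  have h1 : (a / m + b / k) * (m + k) = a + b + (a / m * k + b / k * m) := by
    field_simp; ring
  have h2 : 2 * √(a * b) ≤ a / m * k + b / k * m := by
    have : √(a * b) = √(a / m * k) * √(b / k * m) := by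
      rw [← Real.sqrt_mul (by positivity)]
      congr 1; field_simp
    rw [this]
    have s1 := Real.sq_sqrt (show 0 ≤ a / m * k by positivity)
    have s2 := Real.sq_sqrt (show 0 ≤ b / k * m by positivity)
    nlinarith [sq_nonneg (√(a / m * k) - √(b / k * m))]
  linarith

lemma bm2 {A B : Set (Fin 2 → ℝ)} (hA : IsCompact A) (hB : IsCompact B)
    (hvA : 0 < vol A) (hvB : 0 < vol B) :
    vol A + vol B + 2 * √(vol A * vol B) ≤ vol (A + B) := by
  let e := (MeasurableEquiv.finTwoArrow : (Fin 2 → ℝ) ≃ᵐ ℝ × ℝ)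
  have he : MeasurePreserving e := volume_preserving_finTwoArrow ℝ
  have hc : Continuous e := by
    show Continuous (fun x : Fin 2 → ℝ => (x 0, x 1))
    fun_prop
  have hv : ∀ E : Set (Fin 2 → ℝ), volume (e '' E) = volume E := by
    intro E
    rw [← he.measure_preimage_equiv]
    rw [e.injective.preimage_image]
  have hadd : e '' (A + B) = e '' A + e '' B := by
    have : ∀ x y, e (x + y) = e x + e y := fun x y => rfl
    ext z
    simp only [Set.mem_image, Set.mem_add]
    constructor
    · rintro ⟨_, ⟨a, ha, b, hb, rfl⟩, rfl⟩
      exact ⟨e a, ⟨a, ha, rfl⟩, e b, ⟨b, hb, rfl⟩, (this a b).symm⟩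
    · rintro ⟨_, ⟨a, ha, rfl⟩, _, ⟨b, hb, rfl⟩, rfl⟩
      exact ⟨a + b, ⟨a, ha, b, hb, rfl⟩, this a b⟩
  have := bm2_prod (hA.image hc) (hB.image hc) (by rw [hv]; exact (ENNReal.toReal_pos_iff.mp hvA).1)
    (by rw [hv]; exact (ENNReal.toReal_pos_iff.mp hvB).1)
  rw [← hadd, hv, hv, hv] at this
  exact this

end BM
end AF



namespace AF

section Geo
variable {J : Type} [Fintype J] [DecidableEq J]

/-- polyhedron -/
def P {d : ℕ} (u : J → Fin d → ℝ) (S : Finset J) (h : J → ℝ) : Set (Fin d → ℝ) :=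
  {x | ∀ j ∈ S, u j ⬝ᵥ x ≤ h j}

structure Good {d : ℕ} (u : J → Fin d → ℝ) (S : Finset J) (C : Set (J → ℝ)) : Prop where
  op : IsOpen C
  cv : Convex ℝ C
  cone : ∀ h ∈ C, ∀ t : ℝ, 0 < t → t • h ∈ C
  trans : ∀ h ∈ C, ∀ v : Fin d → ℝ, (fun j => h j + u j ⬝ᵥ v) ∈ C
  ne : C.Nonempty
  Pne : ∀ h ∈ C, (P u S h).Nonempty
  simple : ∀ h ∈ C, ∀ x ∈ P u S h, ∀ τ : J → ℝ, ∃ w, ∀ j ∈ S, u j ⬝ᵥ x = h j → u j ⬝ᵥ w = τ j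
  recc : ∀ x : Fin d → ℝ, (∀ j ∈ S, u j ⬝ᵥ x ≤ 0) → x = 0

lemma cont_dot {d : ℕ} (a : Fin d → ℝ) : Continuous (fun x : Fin d → ℝ => a ⬝ᵥ x) := by
  unfold dotProduct; fun_prop

lemma P_closed {d : ℕ} (u : J → Fin d → ℝ) (S : Finset J) (h : J → ℝ) : IsClosed (P u S h) := by
  have : P u S h = ⋂ j ∈ S, {x | u j ⬝ᵥ x ≤ h j} := by ext; simp [P]
  rw [this]
  exact isClosed_biInter fun j _ => isClosed_le (cont_dot _) continuous_const

lemma P_convex {d : ℕ} (u : J → Fin d → ℝ) (S : Finset J) (h : J → ℝ) : Convex ℝ (P u S h) := by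
  intro x hx y hy a b ha hb hab j hj
  have h1 := hx j hj; have h2 := hy j hj
  rw [dotProduct_add, dotProduct_smul, dotProduct_smul]
  have e : h j = a * h j + b * h j := by rw [← add_mul, hab, one_mul]
  rw [e]
  simp only [smul_eq_mul]
  gcongr

lemma P_add {d : ℕ} (u : J → Fin d → ℝ) (S : Finset J) (h h' : J → ℝ) :
    P u S h + P u S h' ⊆ P u S (h + h') := by
  rintro _ ⟨x, hx, y, hy, rfl⟩ j hj
  show u j ⬝ᵥ (x + y) ≤ h j + h' j
  rw [dotProduct_add]
  exact add_le_add (hx j hj) (hy j hj)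

lemma P_smul {d : ℕ} (u : J → Fin d → ℝ) (S : Finset J) (h : J → ℝ) (t : ℝ) (ht : 0 < t) :
    P u S (t • h) = t • P u S h := by
  ext x
  rw [Set.mem_smul_set_iff_inv_smul_mem₀ ht.ne']
  simp only [P, Set.mem_setOf_eq, dotProduct_smul, Pi.smul_apply, smul_eq_mul]
  refine forall₂_congr fun j _ => ?_
  rw [inv_mul_le_iff₀ ht]

lemma P_trans {d : ℕ} (u : J → Fin d → ℝ) (S : Finset J) (h : J → ℝ) (v : Fin d → ℝ) :
    P u S (fun j => h j + u j ⬝ᵥ v) = v +ᵥ P u S h := by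
  ext x
  rw [Set.mem_vadd_set_iff_neg_vadd_mem]
  simp only [P, Set.mem_setOf_eq, vadd_eq_add, dotProduct_add, dotProduct_neg]
  refine forall₂_congr fun j _ => ?_
  constructor <;> intro h <;> linarith

lemma rec_bound {d : ℕ} (u : J → Fin d → ℝ) (S : Finset J)
    (hr : ∀ x : Fin d → ℝ, (∀ j ∈ S, u j ⬝ᵥ x ≤ 0) → x = 0) :
    ∃ c : ℝ, 0 < c ∧ ∀ x : Fin d → ℝ, x ≠ 0 → ∃ j ∈ S, c * ‖x‖ ≤ u j ⬝ᵥ x := by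
  classical
  by_cases hne : (Metric.sphere (0 : Fin d → ℝ) 1).Nonempty
  · have hS : S.Nonempty := by
      by_contra h
      rw [Finset.not_nonempty_iff_eq_empty] at h
      obtain ⟨x, hx⟩ := hne
      have := hr x (by simp [h])
      simp [this] at hx
    let φ : (Fin d → ℝ) → ℝ := fun x => S.sup' hS (fun j => u j ⬝ᵥ x)
    have hφ : Continuous φ := by
      apply Continuous.finset_sup'_apply
      intro i _; exact cont_dot _
    obtain ⟨x0, hx0, hmin⟩ := (isCompact_sphere (0 : Fin d → ℝ) 1).exists_isMinOn hne hφ.continuousOn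
    refine ⟨φ x0, ?_, ?_⟩
    · by_contra hle
      push Not at hle
      have : x0 = 0 := hr x0 (fun j hj => (Finset.le_sup' (fun j => u j ⬝ᵥ x0) hj).trans hle)
      simp [this] at hx0
    · intro x hx
      have hxn : 0 < ‖x‖ := norm_pos_iff.mpr hx
      have h1 : φ x0 ≤ φ (‖x‖⁻¹ • x) := hmin (by simp [norm_smul, hxn.ne'])
      obtain ⟨j, hj, hje⟩ := Finset.exists_mem_eq_sup' hS (fun j => u j ⬝ᵥ (‖x‖⁻¹ • x))
      refine ⟨j, hj, ?_⟩
      have : φ x0 ≤ u j ⬝ᵥ (‖x‖⁻¹ • x) := by rw [← hje]; exact h1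
      rw [dotProduct_smul, smul_eq_mul, inv_mul_eq_div, le_div_iff₀ hxn] at this
      exact this
  · refine ⟨1, one_pos, fun x hx => ?_⟩
    exfalso; apply hne
    refine ⟨‖x‖⁻¹ • x, ?_⟩
    simp [norm_smul, norm_ne_zero_iff.mpr hx]

lemma P_bound {d : ℕ} (u : J → Fin d → ℝ) (S : Finset J)
    (hr : ∀ x : Fin d → ℝ, (∀ j ∈ S, u j ⬝ᵥ x ≤ 0) → x = 0) :
    ∃ c : ℝ, 0 < c ∧ ∀ h, ∀ x ∈ P u S h, ‖x‖ ≤ c * ‖h‖ := by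
  obtain ⟨c, hc, H⟩ := rec_bound u S hr
  refine ⟨c⁻¹, by positivity, fun h x hx => ?_⟩
  by_cases h0 : x = 0
  · subst h0; simp; positivity
  · obtain ⟨j, hj, hle⟩ := H x h0
    rw [le_inv_mul_iff₀ hc]
    exact hle.trans ((hx j hj).trans ((le_abs_self _).trans (norm_le_pi_norm h j)))

lemma P_compact {d : ℕ} (u : J → Fin d → ℝ) (S : Finset J)
    (hr : ∀ x : Fin d → ℝ, (∀ j ∈ S, u j ⬝ᵥ x ≤ 0) → x = 0) (h : J → ℝ) : IsCompact (P u S h) := by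
  obtain ⟨c, hc, H⟩ := P_bound u S hr
  refine (isCompact_closedBall (0 : Fin d → ℝ) (c * ‖h‖)).of_isClosed_subset (P_closed _ _ _) ?_
  intro x hx; simpa using H h x hx

/-- move along a direction keeping inactive constraints strict -/
lemma small_move {d : ℕ} (u : J → Fin d → ℝ) (S : Finset J) (h : J → ℝ) (x w : Fin d → ℝ)
    (hx : x ∈ P u S h) : ∃ ε : ℝ, 0 < ε ∧ ∀ j ∈ S, u j ⬝ᵥ x ≠ h j → u j ⬝ᵥ (x + ε • w) < h j := by
  have key : ∀ j ∈ S, ∀ᶠ ε in nhdsWithin (0:ℝ) (Set.Ioi 0), u j ⬝ᵥ x ≠ h j → u j ⬝ᵥ (x + ε • w) < h j := by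
    intro j hj
    by_cases hne : u j ⬝ᵥ x = h j
    · simp [hne]
    · have hlt : u j ⬝ᵥ x < h j := lt_of_le_of_ne (hx j hj) hne
      have hc : Continuous (fun ε : ℝ => u j ⬝ᵥ (x + ε • w)) := (cont_dot (u j)).comp (by fun_prop)
      have : ∀ᶠ ε in nhds (0:ℝ), u j ⬝ᵥ (x + ε • w) < h j := by
        apply hc.continuousAt.eventually_lt continuousAt_const
        simpa using hlt
      exact (this.filter_mono nhdsWithin_le_nhds).mono fun _ h _ => h
  have h2 := (Filter.eventually_all_finset S).mpr key
  obtain ⟨ε, h3, h4⟩ := (h2.and self_mem_nhdsWithin).exists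
  exact ⟨ε, h4, h3⟩

namespace Good
variable {d : ℕ} {u : J → Fin d → ℝ} {S : Finset J} {C : Set (J → ℝ)}

lemma exists_strict (G : Good u S C) {h} (hh : h ∈ C) : ∃ x, ∀ j ∈ S, u j ⬝ᵥ x < h j := by
  obtain ⟨x, hx⟩ := G.Pne h hh
  obtain ⟨w, hw⟩ := G.simple h hh x hx (fun _ => -1)
  obtain ⟨ε, hε, H⟩ := small_move u S h x w hx
  refine ⟨x + ε • w, fun j hj => ?_⟩
  by_cases e : u j ⬝ᵥ x = h j
  · rw [dotProduct_add, dotProduct_smul, hw j hj e, e]; simp; exact hε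
  · exact H j hj e

lemma exists_strict_facet (G : Good u S C) {h} (hh : h ∈ C) {i} {x} (hx : x ∈ P u S h)
    (hi : i ∈ S) (hxi : u i ⬝ᵥ x = h i) :
    ∃ x, u i ⬝ᵥ x = h i ∧ ∀ j ∈ S, j ≠ i → u j ⬝ᵥ x < h j := by
  obtain ⟨w, hw⟩ := G.simple h hh x hx (fun j => if j = i then 0 else -1)
  obtain ⟨ε, hε, H⟩ := small_move u S h x w hx
  refine ⟨x + ε • w, ?_, fun j hj hji => ?_⟩
  · rw [dotProduct_add, dotProduct_smul, hw i hi hxi, hxi]; simp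
  by_cases e : u j ⬝ᵥ x = h j
  · rw [dotProduct_add, dotProduct_smul, hw j hj e, e]; simp [hji]; exact hε
  · exact H j hj e

lemma vol_pos (G : Good u S C) {h} (hh : h ∈ C) : 0 < vol (P u S h) := by
  obtain ⟨x, hx⟩ := G.exists_strict hh
  have ho : IsOpen {x | ∀ j ∈ S, u j ⬝ᵥ x < h j} := by
    have : {x | ∀ j ∈ S, u j ⬝ᵥ x < h j} = ⋂ j ∈ S, {x | u j ⬝ᵥ x < h j} := by ext; simp
    rw [this]
    exact isOpen_biInter_finset fun j _ => isOpen_lt (cont_dot _) continuous_const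
  apply ENNReal.toReal_pos
  · have : 0 < volume {x | ∀ j ∈ S, u j ⬝ᵥ x < h j} := ho.measure_pos volume ⟨x, hx⟩
    exact (this.trans_le (measure_mono fun y hy j hj => (hy j hj).le)).ne'
  · exact (P_compact u S G.recc h).measure_lt_top.ne

def Act (u : J → Fin d → ℝ) (S : Finset J) (h : J → ℝ) (i : J) : Prop :=
  i ∈ S ∧ ∃ x ∈ P u S h, u i ⬝ᵥ x = h i

lemma act_const (G : Good u S C) {h h' : J → ℝ} (hh : h ∈ C) (hh' : h' ∈ C) {i : J}
    (ha : Act u S h i) : Act u S h' i := by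
  obtain ⟨hi, ha⟩ := ha
  refine ⟨hi, ?_⟩
  let U : Set (J → ℝ) := {h | ∃ x ∈ P u S h, u i ⬝ᵥ x = h i}
  obtain ⟨c, hc, Hc⟩ := P_bound u S G.recc
  have hcl : IsClosed U := by
    rw [← isOpen_compl_iff, ← isSeqClosed_iff_isClosed.trans isOpen_compl_iff.symm] 
    intro hs h0 hsU hlim
    choose x hxP hxi using hsU
    have hb : Bornology.IsBounded (Set.range hs) := Metric.isBounded_range_of_tendsto hs hlim
    obtain ⟨R, hR⟩ := hb.exists_norm_le
    have hxb : ∀ n, x n ∈ Metric.closedBall (0 : Fin d → ℝ) (c * R) := by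
      intro n
      have := Hc _ _ (hxP n)
      simp only [mem_closedBall_zero_iff]
      exact this.trans (by gcongr; exact hR _ ⟨n, rfl⟩)
    obtain ⟨a, -, φ, hφ, hxa⟩ := (isCompact_closedBall (0 : Fin d → ℝ) (c * R)).tendsto_subseq hxb
    have hl := hlim.comp hφ.tendsto_atTop
    have hd : ∀ j, Filter.Tendsto (fun n => u j ⬝ᵥ x (φ n)) Filter.atTop (nhds (u j ⬝ᵥ a)) :=
      fun j => ((cont_dot (u j)).tendsto a).comp hxa
    have hj : ∀ j, Filter.Tendsto (fun n => hs (φ n) j) Filter.atTop (nhds (h0 j)) :=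
      fun j => (tendsto_pi_nhds.mp hl) j
    refine ⟨a, fun j hjS => le_of_tendsto_of_tendsto' (hd j) (hj j) (fun n => hxP _ j hjS), ?_⟩
    refine tendsto_nhds_unique (hd i) ?_
    simpa [hxi] using hj i
  have hop : ∀ h ∈ C ∩ U, U ∈ nhds h := by
    rintro h ⟨hC, x, hx, hxi⟩
    obtain ⟨w, hw⟩ := G.simple h hC x hx (fun _ => 1)
    have hw1 := hw i hi hxi
    obtain ⟨y, hyi, hy⟩ := G.exists_strict_facet hC hx hi hxi
    have key : ∀ j ∈ S, ∀ᶠ h' in nhds h, j ≠ i → u j ⬝ᵥ (y + (h' i - h i) • w) < h' j := by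
      intro j hj
      by_cases hji : j = i
      · simp [hji]
      · have hc : Continuous (fun h' : J → ℝ => u j ⬝ᵥ (y + (h' i - h i) • w)) :=
          (cont_dot (u j)).comp (by fun_prop)
        have : ∀ᶠ h' in nhds h, u j ⬝ᵥ (y + (h' i - h i) • w) < h' j := by
          apply hc.continuousAt.eventually_lt (continuous_apply j).continuousAt
          simpa using hy j hj hji
        exact this.mono fun _ h _ => h
    have h2 := (Filter.eventually_all_finset S).mpr key
    filter_upwards [h2] with h' h3
    have e : u i ⬝ᵥ (y + (h' i - h i) • w) = h' i := by
      rw [dotProduct_add, dotProduct_smul, hw1, hyi]; simp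
    refine ⟨_, fun j hj => ?_, e⟩
    by_cases hji : j = i
    · subst hji; exact e.le
    · exact (h3 j hj hji).le
  have hpc := G.cv.isPreconnected
  by_contra hn
  obtain ⟨z, hzC, hz⟩ := hpc (interior U) Uᶜ isOpen_interior hcl.isOpen_compl
    (fun z hz => by
      by_cases hzU : z ∈ U
      · left; exact mem_interior_iff_mem_nhds.mpr (hop z ⟨hz, hzU⟩)
      · right; exact hzU)
    ⟨h, hh, mem_interior_iff_mem_nhds.mpr (hop h ⟨hh, ha⟩)⟩ ⟨h', hh', hn⟩
  exact hz.2 (interior_subset hz.1)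

lemma act_ne_zero (G : Good u S C) {h : J → ℝ} (hh : h ∈ C) {i : J}
    (ha : Act u S h i) : ∃ k, u i k ≠ 0 := by
  obtain ⟨hi, x, hx, hxi⟩ := ha
  obtain ⟨w, hw⟩ := G.simple h hh x hx (fun _ => 1)
  by_contra hn
  push Not at hn
  have : u i = 0 := funext hn
  have := hw i hi hxi
  simp_all

end Good
end Geo
end AF



namespace AF

section Facet
variable {J : Type} [Fintype J] [DecidableEq J]
variable {d : ℕ}

/-- facet normals -/
noncomputable def fu (u : J → Fin (d+1) → ℝ) (i : J) (k : Fin (d+1)) : J → Fin d → ℝ :=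
  fun j l => u j (k.succAbove l) - u j k / u i k * u i (k.succAbove l)

noncomputable def fc (u : J → Fin (d+1) → ℝ) (i : J) (k : Fin (d+1)) : J → ℝ :=
  fun j => if j = i then 0 else u j k / u i k

noncomputable def sec (u : J → Fin (d+1) → ℝ) (i : J) (k : Fin (d+1)) (s : ℝ) (y : Fin d → ℝ) : Fin (d+1) → ℝ :=
  k.insertNth ((s - ∑ l, u i (k.succAbove l) * y l) / u i k) y

lemma dot_insertNth (k : Fin (d+1)) (a : Fin (d+1) → ℝ) (t : ℝ) (y : Fin d → ℝ) :
    a ⬝ᵥ (k.insertNth t y : Fin (d+1) → ℝ) = a k * t + ∑ l, a (k.succAbove l) * y l := by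
  simp [dotProduct, Fin.sum_univ_succAbove _ k]

lemma dot_sec (u : J → Fin (d+1) → ℝ) (i : J) (k : Fin (d+1)) (hk : u i k ≠ 0) (s : ℝ) (y : Fin d → ℝ) (j : J) :
    u j ⬝ᵥ sec u i k s y = fu u i k j ⬝ᵥ y + u j k / u i k * s := by
  rw [sec, dot_insertNth]
  simp only [dotProduct, fu, sub_mul, Finset.sum_sub_distrib, mul_assoc, ← Finset.mul_sum]
  field_simp
  ring

lemma dot_sec_self (u : J → Fin (d+1) → ℝ) (i : J) (k : Fin (d+1)) (hk : u i k ≠ 0) (s : ℝ) (y : Fin d → ℝ) :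
    u i ⬝ᵥ sec u i k s y = s := by
  rw [sec, dot_insertNth]
  field_simp
  ring

lemma fu_self (u : J → Fin (d+1) → ℝ) (i : J) (k : Fin (d+1)) (hk : u i k ≠ 0) : fu u i k i = 0 := by
  ext l; simp [fu, hk]

lemma sec_self (u : J → Fin (d+1) → ℝ) (i : J) (k : Fin (d+1)) (hk : u i k ≠ 0) (x : Fin (d+1) → ℝ) :
    sec u i k (u i ⬝ᵥ x) (fun l => x (k.succAbove l)) = x := by
  have : (u i ⬝ᵥ x - ∑ l, u i (k.succAbove l) * x (k.succAbove l)) / u i k = x k := by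
    simp [dotProduct, Fin.sum_univ_succAbove _ k, hk]
  rw [sec, this]
  exact Fin.insertNth_self_removeNth k x

lemma mem_facet (u : J → Fin (d+1) → ℝ) (i : J) (k : Fin (d+1)) (hk : u i k ≠ 0) (S : Finset J) (h : J → ℝ)
    (y : Fin d → ℝ) :
    sec u i k (h i) y ∈ P u S h ↔ y ∈ P (fu u i k) (S.erase i) (Lm i (fc u i k) h) := by
  constructor
  · intro H j hj
    have hji := (Finset.mem_erase.mp hj).1
    have := H j (Finset.mem_erase.mp hj).2
    rw [dot_sec u i k hk] at this
    simp only [Lm, fc, hji, if_false]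
    linarith
  · intro H j hj
    by_cases hji : j = i
    · subst hji; exact (dot_sec_self u j k hk _ _).le
    · have := H j (Finset.mem_erase.mpr ⟨hji, hj⟩)
      simp only [Lm, fc, hji, if_false] at this
      rw [dot_sec u i k hk]; linarith

lemma Lm_inv (i : J) (c : J → ℝ) (hc : c i = 0) (h : J → ℝ) : Lm i (-c) (Lm i c h) = h := by
  ext j; simp [Lm, hc]

lemma Lm_inv' (i : J) (c : J → ℝ) (hc : c i = 0) (h : J → ℝ) : Lm i c (Lm i (-c) h) = h := by
  ext j; simp [Lm, hc]

lemma cont_Lm (i : J) (c : J → ℝ) : Continuous (Lm i c) := by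
  unfold Lm; fun_prop

lemma fc_self (u : J → Fin (d+1) → ℝ) (i : J) (k : Fin (d+1)) : fc u i k i = 0 := by simp [fc]

lemma Lm_add (i : J) (c : J → ℝ) (g h : J → ℝ) : Lm i c (g + h) = Lm i c g + Lm i c h := by
  ext j; simp [Lm]; ring

lemma Lm_smul (i : J) (c : J → ℝ) (t : ℝ) (h : J → ℝ) : Lm i c (t • h) = t • Lm i c h := by
  ext j; simp [Lm]; ring

lemma sec_dot_succ (u : J → Fin (d+1) → ℝ) (i : J) (k : Fin (d+1)) (hk : u i k ≠ 0) (w : Fin (d+1) → ℝ) (j : J) :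
    fu u i k j ⬝ᵥ (fun l => w (k.succAbove l)) = u j ⬝ᵥ w - u j k / u i k * (u i ⬝ᵥ w) := by
  have h1 := dot_sec u i k hk (u i ⬝ᵥ w) (fun l => w (k.succAbove l)) j
  rw [sec_self u i k hk] at h1
  linarith

lemma Good.facet {u : J → Fin (d+1) → ℝ} {S : Finset J} {C : Set (J → ℝ)} (G : Good u S C)
    {h0 : J → ℝ} (hh0 : h0 ∈ C) {i : J} (ha : Good.Act u S h0 i) (k : Fin (d+1)) (hk : u i k ≠ 0) :
    Good (fu u i k) (S.erase i) (Lm i (fc u i k) '' C) := by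
  have hcs := fc_self u i k
  refine ⟨?_, ?_, ?_, ?_, G.ne.image _, ?_, ?_, ?_⟩
  · have : Lm i (fc u i k) '' C = Lm i (-fc u i k) ⁻¹' C := by
      ext h
      constructor
      · rintro ⟨g, hg, rfl⟩
        simpa [Lm_inv i _ hcs] using hg
      · intro hh; exact ⟨_, hh, Lm_inv' i _ hcs h⟩
    rw [this]; exact G.op.preimage (cont_Lm _ _)
  · rintro _ ⟨g, hg, rfl⟩ _ ⟨h, hh, rfl⟩ a b ha hb hab
    exact ⟨a • g + b • h, G.cv hg hh ha hb hab, by rw [Lm_add, Lm_smul, Lm_smul]⟩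
  · rintro _ ⟨g, hg, rfl⟩ t ht
    exact ⟨t • g, G.cone g hg t ht, Lm_smul _ _ _ _⟩
  · rintro _ ⟨g, hg, rfl⟩ v
    refine ⟨_, G.trans g hg (sec u i k 0 v), ?_⟩
    ext j
    simp only [Lm, dot_sec u i k hk, fu_self u i k hk]
    simp; ring
  · rintro _ ⟨g, hg, rfl⟩
    obtain ⟨hi, x, hx, hxi⟩ := G.act_const hh0 hg ha
    refine ⟨fun l => x (k.succAbove l), (mem_facet u i k hk S g _).mp ?_⟩
    rw [← hxi, sec_self u i k hk]; exact hx
  · rintro _ ⟨g, hg, rfl⟩ y hy τ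
    have hx := (mem_facet u i k hk S g _).mpr hy
    obtain ⟨w, hw⟩ := G.simple g hg _ hx (fun j => if j = i then 0 else τ j)
    refine ⟨fun l => w (k.succAbove l), fun j hj hja => ?_⟩
    obtain ⟨hji, hjS⟩ := Finset.mem_erase.mp hj
    have hwi := hw i ha.1 (dot_sec_self u i k hk _ _)
    rw [sec_dot_succ u i k hk, hwi, hw j hjS]
    · simp [hji]
    · rw [dot_sec u i k hk, hja]; simp [Lm, fc, hji]
  · intro y hy
    have : sec u i k 0 y = 0 := by
      apply G.recc
      intro j hj
      by_cases hji : j = i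
      · subst hji; exact (dot_sec_self u j k hk _ _).le
      · rw [dot_sec u i k hk]; simpa using hy j (Finset.mem_erase.mpr ⟨hji, hj⟩)
    ext l
    have h2 := congrFun this (k.succAbove l)
    simpa [sec] using h2

/-- Fubini along a facet direction -/
lemma fubini (u : J → Fin (d+1) → ℝ) (i : J) (k : Fin (d+1)) (hk : u i k ≠ 0)
    {A : Set (Fin (d+1) → ℝ)} (hA : MeasurableSet A) :
    volume A = ENNReal.ofReal (|u i k|⁻¹) * ∫⁻ s : ℝ, volume {y : Fin d → ℝ | sec u i k s y ∈ A} := by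
  have h1 := (volume_preserving_piFinSuccAbove (fun _ : Fin (d+1) => ℝ) k).symm
  have h2 : volume A = volume ((MeasurableEquiv.piFinSuccAbove (fun _ : Fin (d+1) => ℝ) k).symm ⁻¹' A) :=
    (h1.measure_preimage hA.nullMeasurableSet).symm
  have hB : MeasurableSet ((MeasurableEquiv.piFinSuccAbove (fun _ : Fin (d+1) => ℝ) k).symm ⁻¹' A) :=
    hA.preimage (MeasurableEquiv.measurable _)
  have hsm : Measurable (fun p : ℝ × (Fin d → ℝ) => sec u i k p.1 p.2) := by
    have e : (fun p : ℝ × (Fin d → ℝ) => sec u i k p.1 p.2) =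
      (MeasurableEquiv.piFinSuccAbove (fun _ : Fin (d+1) => ℝ) k).symm ∘
        (fun p : ℝ × (Fin d → ℝ) => ((p.1 - ∑ l, u i (k.succAbove l) * p.2 l) / u i k, p.2)) := by
      funext p; rfl
    rw [e]
    apply (MeasurableEquiv.measurable _).comp
    fun_prop
  have hE : MeasurableSet ((fun p : ℝ × (Fin d → ℝ) => sec u i k p.1 p.2) ⁻¹' A) := hsm hA
  have h3 : ∫⁻ s : ℝ, volume {y : Fin d → ℝ | sec u i k s y ∈ A} =
      (volume.prod volume) ((fun p : ℝ × (Fin d → ℝ) => sec u i k p.1 p.2) ⁻¹' A) := by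
    rw [Measure.prod_apply hE]; rfl
  rw [h2, h3, Measure.volume_eq_prod, Measure.prod_apply_symm hB, Measure.prod_apply_symm hE,
    ← lintegral_const_mul]
  · apply lintegral_congr
    intro y
    set T : Set ℝ := (fun a : ℝ => ((a, y) : ℝ × (Fin d → ℝ))) ⁻¹' ((MeasurableEquiv.piFinSuccAbove (fun _ : Fin (d+1) => ℝ) k).symm ⁻¹' A) with hT
    set β := ∑ l, u i (k.succAbove l) * y l
    have : (fun s : ℝ => ((s, y) : ℝ × (Fin d → ℝ))) ⁻¹' ((fun p : ℝ × (Fin d → ℝ) => sec u i k p.1 p.2) ⁻¹' A)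
        = (fun s => s + -β) ⁻¹' ((fun r => r * (u i k)⁻¹) ⁻¹' T) := by
      ext s; rfl
    rw [this, measure_preimage_add_right, Real.volume_preimage_mul_right (inv_ne_zero hk), ← mul_assoc,
      ← ENNReal.ofReal_mul (by positivity)]
    simp [abs_ne_zero.mpr hk]
  · exact measurable_measure_prodMk_right hE

end Facet
end AF



namespace AF

section Der
variable {J : Type} [Fintype J] [DecidableEq J]

/-- continuous partial derivatives imply directional derivative -/
lemma partials (V : (J → ℝ) → ℝ) (C : Set (J → ℝ)) (hC : IsOpen C) (g : J → (J → ℝ) → ℝ)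
    (hg : ∀ i, Continuous (g i))
    (hV : ∀ h ∈ C, ∀ i, HasDerivAt (fun t : ℝ => V (h + t • Pi.single i 1)) (g i h) 0)
    (h : J → ℝ) (hh : h ∈ C) (v : J → ℝ) :
    HasDerivAt (fun t : ℝ => V (h + t • v)) (∑ i, v i * g i h) 0 := by
  classical
  -- main estimate
  have main : ∀ ε > 0, ∃ r > 0, ∀ δ : J → ℝ, ‖δ‖ < r →
      |V (h + δ) - V h - ∑ i, δ i * g i h| ≤ ε * ∑ i, |δ i| := by
    intro ε hε
    have e1 : ∀ᶠ y in nhds h, ∀ i ∈ (Finset.univ : Finset J), |g i y - g i h| < ε := by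
      rw [Filter.eventually_all_finset]
      intro i _
      have := (hg i).continuousAt (x := h)
      rw [Metric.continuousAt_iff'] at this
      exact this ε hε
    have e2 : ∀ᶠ y in nhds h, y ∈ C := hC.mem_nhds hh
    obtain ⟨r, hr, H⟩ := Metric.eventually_nhds_iff_ball.mp (e1.and e2)
    refine ⟨r, hr, fun δ hδ => ?_⟩
    have ind : ∀ T : Finset J, |V (h + ∑ i ∈ T, δ i • Pi.single i (1:ℝ)) - V h - ∑ i ∈ T, δ i * g i h|
        ≤ ε * ∑ i ∈ T, |δ i| := by
      intro T
      induction T using Finset.induction_on with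
      | empty => simp
      | insert i T hi ih =>
        set z := h + ∑ i ∈ T, δ i • Pi.single i (1:ℝ) with hz
        have hball : ∀ t ∈ Set.uIcc 0 (δ i), z + t • Pi.single i (1:ℝ) ∈ Metric.ball h r := by
          intro t ht
          rw [Metric.mem_ball, dist_pi_lt_iff hr]
          intro j
          have hδj : |δ j| < r := (norm_le_pi_norm δ j).trans_lt hδ
          have hzj : (∑ i ∈ T, δ i • Pi.single i (1:ℝ) : J → ℝ) j = if j ∈ T then δ j else 0 := by
            simp [Finset.sum_apply, Pi.single_apply]
          by_cases hji : j = i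
          · subst hji
            have : |t| ≤ |δ j| := by
              have := Set.abs_sub_left_of_mem_uIcc ht
              simpa using this
            simp only [hz, Pi.add_apply, hzj, hi, if_false, Pi.smul_apply, Pi.single_eq_same, Real.dist_eq]
            simp; linarith
          · simp only [hz, Pi.add_apply, hzj, Pi.smul_apply, Pi.single_eq_of_ne hji, Real.dist_eq]
            by_cases hjT : j ∈ T <;> simp [hjT, hδj, hr]
        have hder : ∀ t ∈ Set.uIcc 0 (δ i), HasDerivWithinAt
            (fun t : ℝ => V (z + t • Pi.single i (1:ℝ)) - t * g i h)
            (g i (z + t • Pi.single i (1:ℝ)) - g i h) (Set.uIcc 0 (δ i)) t := by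
          intro t ht
          have h1 := hV _ (H _ (hball t ht)).2 i
          have h2 : HasDerivAt (fun s : ℝ => V (z + s • Pi.single i (1:ℝ))) (g i (z + t • Pi.single i (1:ℝ))) t := by
            have h3 := HasDerivAt.comp_sub_const (f := fun s : ℝ => V (z + t • Pi.single i (1:ℝ) + s • Pi.single i 1)) (x := t) (a := t) (by simpa using h1)
            refine h3.congr_of_eventuallyEq (Filter.Eventually.of_forall fun s => ?_)
            simp only
            congr 1
            rw [add_assoc z, ← add_smul]; congr 2; ring
          have h4 := h2.sub ((hasDerivAt_id t).mul_const (g i h))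
          simp only [one_mul] at h4
          exact h4.hasDerivWithinAt
        have mvt := (convex_uIcc 0 (δ i)).norm_image_sub_le_of_norm_hasDerivWithin_le (C := ε) hder
          (fun t ht => ((H _ (hball t ht)).1 i (Finset.mem_univ _)).le) Set.left_mem_uIcc Set.right_mem_uIcc
        simp only [zero_smul, add_zero, zero_mul, sub_zero, Real.norm_eq_abs] at mvt
        rw [Finset.sum_insert hi, Finset.sum_insert hi, Finset.sum_insert hi, mul_add]
        have e : h + (δ i • Pi.single i (1:ℝ) + ∑ i ∈ T, δ i • Pi.single i (1:ℝ)) = z + δ i • Pi.single i (1:ℝ) := by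
          rw [hz]; abel
        rw [e]
        calc _ = |(V (z + δ i • Pi.single i (1:ℝ)) - δ i * g i h - V z) + (V z - V h - ∑ i ∈ T, δ i * g i h)| := by
              congr 1; ring
          _ ≤ _ := (abs_add_le _ _).trans (add_le_add mvt ih)
    have := ind Finset.univ
    have e : (∑ i, δ i • Pi.single i (1:ℝ) : J → ℝ) = δ := by
      ext j; simp [Finset.sum_apply, Pi.single_apply]
    rwa [e] at this
  rw [hasDerivAt_iff_isLittleO, Asymptotics.isLittleO_iff]
  intro c hc
  set sv := ∑ i, |v i| with hs
  have hs0 : 0 ≤ sv := Finset.sum_nonneg fun _ _ => abs_nonneg _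
  obtain ⟨r, hr, H⟩ := main (c / (sv + 1)) (by positivity)
  have hc1 : ∀ᶠ t : ℝ in nhds 0, ‖t • v‖ < r := by
    have : Continuous (fun t : ℝ => ‖t • v‖) := by fun_prop
    exact this.continuousAt.eventually_lt continuousAt_const (by simpa using hr)
  filter_upwards [hc1] with t ht
  have h1 := H (t • v) ht
  simp only [zero_smul, add_zero, sub_zero, Real.norm_eq_abs, smul_eq_mul]
  have e1 : ∑ i, (t • v) i * g i h = t * ∑ i, v i * g i h := by
    rw [Finset.mul_sum]; apply Finset.sum_congr rfl; intro i _; simp; ring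
  have e2 : ∑ i, |(t • v) i| = |t| * sv := by
    rw [hs, Finset.mul_sum]; apply Finset.sum_congr rfl; intro i _; simp [abs_mul]
  rw [e1, e2] at h1
  refine h1.trans ?_
  have : c / (sv + 1) * sv ≤ c := by
    rw [div_mul_eq_mul_div, div_le_iff₀ (by positivity)]; nlinarith
  calc c / (sv + 1) * (|t| * sv) = (c / (sv + 1) * sv) * |t| := by ring
    _ ≤ c * |t| := by gcongr

lemma mem_P_single {d : ℕ} (u : J → Fin d → ℝ) {S : Finset J} {i : J} (hi : i ∈ S) (h : J → ℝ) (t : ℝ) (x) :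
    x ∈ P u S (h + t • Pi.single i 1) ↔ u i ⬝ᵥ x ≤ h i + t ∧ ∀ j ∈ S, j ≠ i → u j ⬝ᵥ x ≤ h j := by
  constructor
  · intro H
    refine ⟨by simpa using H i hi, fun j hj hji => by simpa [Pi.single_eq_of_ne hji] using H j hj⟩
  · rintro ⟨h1, h2⟩ j hj
    by_cases hji : j = i
    · subst hji; simpa using h1
    · simpa [Pi.single_eq_of_ne hji] using h2 j hj hji

variable {d : ℕ}

lemma vol_diff (u : J → Fin (d+1) → ℝ) {S : Finset J} {i : J} (hi : i ∈ S) (k : Fin (d+1)) (hk : u i k ≠ 0)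
    (h : J → ℝ) (t : ℝ) (ht : 0 ≤ t) :
    volume (P u S (h + t • Pi.single i 1)) = volume (P u S h) + ENNReal.ofReal (|u i k|⁻¹) *
      ∫⁻ r in Set.Ioc 0 t, volume (P (fu u i k) (S.erase i) (Lm i (fc u i k) (h + r • Pi.single i 1))) := by
  have h0 : ∀ x, x ∈ P u S h ↔ u i ⬝ᵥ x ≤ h i ∧ ∀ j ∈ S, j ≠ i → u j ⬝ᵥ x ≤ h j := by
    intro x; simpa using mem_P_single u hi h 0 x
  have hsub : P u S h ⊆ P u S (h + t • Pi.single i 1) := by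
    intro x hx
    rw [mem_P_single u hi]; rw [h0] at hx
    exact ⟨by linarith [hx.1], hx.2⟩
  have hm := (P_closed u S h).measurableSet
  have hm2 := (P_closed u S (h + t • Pi.single i 1)).measurableSet
  rw [← measure_inter_add_diff (P u S (h + t • Pi.single i 1)) hm, Set.inter_eq_right.mpr hsub,
    fubini u i k hk (hm2.diff hm)]
  congr 2
  rw [← lintegral_add_right_eq_self _ (h i), ← lintegral_indicator measurableSet_Ioc]
  apply lintegral_congr
  intro s
  have e : ∀ y, sec u i k (s + h i) y ∈ P u S (h + t • Pi.single i 1) \ P u S h ↔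
      (s ∈ Set.Ioc 0 t ∧ y ∈ P (fu u i k) (S.erase i) (Lm i (fc u i k) (h + s • Pi.single i 1))) := by
    intro y
    rw [← mem_facet u i k hk S]
    have : (h + s • Pi.single i 1 : J → ℝ) i = s + h i := by simp; ring
    rw [this, Set.mem_diff, mem_P_single u hi, h0, mem_P_single u hi, dot_sec_self u i k hk, Set.mem_Ioc]
    constructor
    · rintro ⟨⟨a, b⟩, c⟩
      have : ¬ (s + h i ≤ h i) := fun hc => c ⟨hc, b⟩
      refine ⟨⟨by linarith, by linarith⟩, by linarith, b⟩
    · rintro ⟨⟨a, b⟩, c, e⟩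
      refine ⟨⟨by linarith, e⟩, fun hc => by linarith [hc.1]⟩
  by_cases hs : s ∈ Set.Ioc 0 t
  · rw [Set.indicator_of_mem hs]
    congr 1
    ext y; rw [Set.mem_setOf_eq, e]; simp [hs]
  · rw [Set.indicator_of_notMem hs]
    have : {y | sec u i k (s + h i) y ∈ P u S (h + t • Pi.single i 1) \ P u S h} = ∅ := by
      ext y; rw [Set.mem_setOf_eq, e]; simp [hs]
    rw [this]; simp

lemma seg_mem {C : Set (J → ℝ)} (hC : Convex ℝ C) {h v : J → ℝ} {t r : ℝ} (h0 : h ∈ C) (h1 : h + t • v ∈ C)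
    (hr0 : 0 ≤ r) (hrt : r ≤ t) : h + r • v ∈ C := by
  rcases hr0.eq_or_lt with e | e
  · simpa [← e] using h0
  have ht : 0 < t := by linarith
  have := hC.add_smul_mem h0 h1 (t := r / t) ⟨by positivity, by rw [div_le_one ht]; exact hrt⟩
  rwa [smul_smul, div_mul_cancel₀ _ ht.ne'] at this

lemma vol_diff_real {u : J → Fin (d+1) → ℝ} {S : Finset J} {C : Set (J → ℝ)} (G : Good u S C)
    {i : J} (hi : i ∈ S) (k : Fin (d+1)) (hk : u i k ≠ 0) (fi : MvPolynomial J ℝ)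
    (hfi : ∀ g ∈ C, vol (P (fu u i k) (S.erase i) (Lm i (fc u i k) g)) = MvPolynomial.eval (Lm i (fc u i k) g) fi)
    (hcp : ∀ g ∈ C, IsCompact (P (fu u i k) (S.erase i) (Lm i (fc u i k) g)))
    {h : J → ℝ} (hh : h ∈ C) {t : ℝ} (ht : 0 ≤ t) (hht : h + t • Pi.single i 1 ∈ C) :
    vol (P u S (h + t • Pi.single i 1)) = vol (P u S h) + |u i k|⁻¹ *
      ∫ r in (0:ℝ)..t, MvPolynomial.eval (Lm i (fc u i k) (h + r • Pi.single i 1)) fi := by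
  have key := vol_diff u hi k hk h t ht
  have hφ : Continuous fun r : ℝ => MvPolynomial.eval (Lm i (fc u i k) (h + r • Pi.single i 1)) fi :=
    (continuous_eval fi).comp ((cont_Lm _ _).comp (by fun_prop))
  have hmem : ∀ r ∈ Set.Ioc 0 t, h + r • Pi.single i 1 ∈ C := fun r hr => seg_mem G.cv hh hht hr.1.le hr.2
  have e1 : ∫⁻ r in Set.Ioc 0 t, volume (P (fu u i k) (S.erase i) (Lm i (fc u i k) (h + r • Pi.single i 1)))
      = ∫⁻ r in Set.Ioc 0 t, ENNReal.ofReal (MvPolynomial.eval (Lm i (fc u i k) (h + r • Pi.single i 1)) fi) := by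
    apply setLIntegral_congr_fun measurableSet_Ioc
    intro r hr
    simp only
    rw [← hfi _ (hmem r hr), vol, ENNReal.ofReal_toReal (hcp _ (hmem r hr)).measure_lt_top.ne]
  have hint : IntegrableOn (fun r : ℝ => MvPolynomial.eval (Lm i (fc u i k) (h + r • Pi.single i 1)) fi) (Set.Ioc 0 t) :=
    (hφ.integrableOn_Icc).mono_set Set.Ioc_subset_Icc_self
  have hnn : 0 ≤ᵐ[volume.restrict (Set.Ioc 0 t)] (fun r : ℝ => MvPolynomial.eval (Lm i (fc u i k) (h + r • Pi.single i 1)) fi) := by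
    refine (ae_restrict_iff' measurableSet_Ioc).mpr (Filter.Eventually.of_forall fun r hr => ?_)
    simp only [Pi.zero_apply]
    rw [← hfi _ (hmem r hr)]; exact ENNReal.toReal_nonneg
  rw [e1, ← ofReal_integral_eq_lintegral_ofReal hint hnn] at key
  rw [intervalIntegral.integral_of_le ht, vol, vol, key, ENNReal.toReal_add, ENNReal.toReal_mul,
    ENNReal.toReal_ofReal (by positivity), ENNReal.toReal_ofReal (integral_nonneg_of_ae hnn)]
  · exact (P_compact u S G.recc h).measure_lt_top.ne
  · exact ENNReal.mul_ne_top ENNReal.ofReal_ne_top ENNReal.ofReal_ne_top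

lemma near_mem {C : Set (J → ℝ)} (hC : IsOpen C) {h : J → ℝ} (hh : h ∈ C) (v : J → ℝ) :
    ∀ᶠ t : ℝ in nhds 0, h + t • v ∈ C := by
  have hc : Continuous (fun t : ℝ => h + t • v) := by fun_prop
  exact hc.continuousAt.eventually_mem (by simpa using hC.mem_nhds hh)

lemma vol_deriv_act {u : J → Fin (d+1) → ℝ} {S : Finset J} {C : Set (J → ℝ)} (G : Good u S C)
    {i : J} (hi : i ∈ S) (k : Fin (d+1)) (hk : u i k ≠ 0) (fi : MvPolynomial J ℝ)
    (hfi : ∀ g ∈ C, vol (P (fu u i k) (S.erase i) (Lm i (fc u i k) g)) = MvPolynomial.eval (Lm i (fc u i k) g) fi)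
    (hcp : ∀ g ∈ C, IsCompact (P (fu u i k) (S.erase i) (Lm i (fc u i k) g)))
    {h : J → ℝ} (hh : h ∈ C) :
    HasDerivAt (fun t : ℝ => vol (P u S (h + t • Pi.single i 1)))
      (MvPolynomial.eval h (|u i k|⁻¹ • sub i (fc u i k) fi)) 0 := by
  set φ := fun r : ℝ => MvPolynomial.eval (Lm i (fc u i k) (h + r • Pi.single i 1)) fi with hφd
  have hφ : Continuous φ :=
    (continuous_eval fi).comp ((cont_Lm _ _).comp (by fun_prop))
  have h1 : HasDerivAt (fun t : ℝ => vol (P u S h) + |u i k|⁻¹ * ∫ r in (0:ℝ)..t, φ r) (|u i k|⁻¹ * φ 0) 0 :=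
    ((hφ.integral_hasStrictDerivAt 0 0).hasDerivAt.const_mul _).const_add _
  have e : MvPolynomial.eval h (|u i k|⁻¹ • sub i (fc u i k) fi) = |u i k|⁻¹ * φ 0 := by
    simp [MvPolynomial.smul_eval, eval_sub, hφd]
  rw [e]
  refine h1.congr_of_eventuallyEq ?_
  filter_upwards [near_mem G.op hh (Pi.single i 1)] with t ht
  rcases le_total 0 t with h0 | h0
  · exact vol_diff_real G hi k hk fi hfi hcp hh h0 ht
  · have := vol_diff_real G hi k hk fi hfi hcp ht (t := -t) (by linarith) (by simpa using hh)
    have e2 : h + t • Pi.single i 1 + (-t) • Pi.single i (1:ℝ) = h := by simp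
    rw [e2] at this
    have e3 : ∀ r : ℝ, MvPolynomial.eval (Lm i (fc u i k) (h + t • Pi.single i 1 + r • Pi.single i 1)) fi = φ (r + t) := by
      intro r; simp only [hφd]; congr 2; rw [add_assoc, ← add_smul, add_comm r]
    simp only [e3] at this
    rw [intervalIntegral.integral_comp_add_right] at this
    simp only [zero_add, neg_add_cancel] at this
    rw [this, intervalIntegral.integral_symm t 0]
    ring

lemma P_const_nonact {u : J → Fin d → ℝ} {S : Finset J} {C : Set (J → ℝ)} (G : Good u S C)
    {i : J} {h : J → ℝ} (hh : h ∈ C) (hna : ¬ Good.Act u S h i) {t : ℝ} (ht : 0 ≤ t)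
    (hht : h + t • Pi.single i 1 ∈ C) : P u S (h + t • Pi.single i 1) = P u S h := by
  by_cases hi : i ∈ S
  · ext x
    have h0 : x ∈ P u S h ↔ u i ⬝ᵥ x ≤ h i ∧ ∀ j ∈ S, j ≠ i → u j ⬝ᵥ x ≤ h j := by
      simpa using mem_P_single u hi h 0 x
    rw [h0, mem_P_single u hi]
    constructor
    · rintro ⟨a, b⟩
      refine ⟨?_, b⟩
      by_contra hlt
      push Not at hlt
      have hm := seg_mem G.cv hh hht (r := u i ⬝ᵥ x - h i) (by linarith) (by linarith)
      apply hna
      refine G.act_const hm hh ⟨hi, x, ?_, by simp⟩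
      rw [mem_P_single u hi]
      exact ⟨by linarith, b⟩
    · rintro ⟨a, b⟩; exact ⟨by linarith, b⟩
  · ext x
    simp only [P, Set.mem_setOf_eq]
    refine forall₂_congr fun j hj => ?_
    have : j ≠ i := fun e => hi (e ▸ hj)
    simp [Pi.single_eq_of_ne this]

lemma vol_deriv_nonact {u : J → Fin d → ℝ} {S : Finset J} {C : Set (J → ℝ)} (G : Good u S C)
    {i : J} {h : J → ℝ} (hh : h ∈ C) (hna : ¬ Good.Act u S h i) :
    HasDerivAt (fun t : ℝ => vol (P u S (h + t • Pi.single i 1))) 0 0 := by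
  refine (hasDerivAt_const (0:ℝ) (vol (P u S h))).congr_of_eventuallyEq ?_
  filter_upwards [near_mem G.op hh (Pi.single i 1)] with t ht
  rcases le_total 0 t with h0 | h0
  · rw [P_const_nonact G hh hna h0 ht]
  · have := P_const_nonact G ht (i := i) (fun ha => hna (G.act_const ht hh ha)) (t := -t) (by linarith) (by simpa using hh)
    have e2 : h + t • Pi.single i 1 + (-t) • Pi.single i (1:ℝ) = h := by simp
    rw [e2] at this
    rw [this]

lemma vol_smul (u : J → Fin d → ℝ) (S : Finset J) (h : J → ℝ) (t : ℝ) (ht : 0 < t) :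
    vol (P u S (t • h)) = t ^ d * vol (P u S h) := by
  rw [P_smul u S h t ht, vol, Measure.addHaar_smul, ENNReal.toReal_mul, vol]
  simp [abs_of_pos ht, ht.le]

/-- `f` represents the volume -/
def Rep (u : J → Fin d → ℝ) (S : Finset J) (C : Set (J → ℝ)) (f : MvPolynomial J ℝ) : Prop :=
  f.IsHomogeneous d ∧ ∀ h ∈ C, vol (P u S h) = MvPolynomial.eval h f

theorem exists_rep : ∀ {d : ℕ} {u : J → Fin d → ℝ} {S : Finset J} {C : Set (J → ℝ)} (G : Good u S C),
    ∃ f, Rep u S C f := by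
  classical
  intro d
  induction d with
  | zero =>
    intro u S C G
    refine ⟨1, MvPolynomial.isHomogeneous_one _ _, fun h hh => ?_⟩
    obtain ⟨x, hx⟩ := G.Pne h hh
    have : P u S h = Set.univ := Set.eq_univ_of_forall fun y => by rwa [Subsingleton.elim y x]
    rw [this, vol]; simp [volume_pi]
  | succ d ih =>
    intro u S C G
    obtain ⟨h0, hh0⟩ := G.ne
    have key : ∀ i, ∃ g : MvPolynomial J ℝ, g.IsHomogeneous d ∧
        ∀ h ∈ C, HasDerivAt (fun t : ℝ => vol (P u S (h + t • Pi.single i 1))) (MvPolynomial.eval h g) 0 := by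
      intro i
      by_cases ha : Good.Act u S h0 i
      · obtain ⟨k, hk⟩ := G.act_ne_zero hh0 ha
        have Gi := G.facet hh0 ha k hk
        obtain ⟨fi, hfi, hfe⟩ := ih Gi
        refine ⟨|u i k|⁻¹ • sub i (fc u i k) fi, ?_, fun h hh => ?_⟩
        · rw [MvPolynomial.smul_eq_C_mul]
          simpa using (MvPolynomial.isHomogeneous_C J _).mul (sub_homog i (fc u i k) hfi)
        · exact vol_deriv_act G ha.1 k hk fi (fun g hg => hfe _ ⟨g, hg, rfl⟩)
            (fun g hg => P_compact _ _ Gi.recc _) hh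
      · refine ⟨0, MvPolynomial.isHomogeneous_zero _ _ _, fun h hh => ?_⟩
        simpa using vol_deriv_nonact G hh (fun h' => ha (G.act_const hh hh0 h'))
    choose g hg hgd using key
    refine ⟨((d:ℝ)+1)⁻¹ • ∑ i, MvPolynomial.X i * g i, ?_, fun h hh => ?_⟩
    · rw [MvPolynomial.smul_eq_C_mul]
      have : (∑ i, MvPolynomial.X i * g i).IsHomogeneous (d+1) := by
        apply MvPolynomial.IsHomogeneous.sum
        intro i _
        rw [add_comm]
        exact (MvPolynomial.isHomogeneous_X ℝ i).mul (hg i)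
      simpa using (MvPolynomial.isHomogeneous_C J _).mul this
    · have h1 := partials (fun h => vol (P u S h)) C G.op (fun i h => MvPolynomial.eval h (g i))
        (fun i => continuous_eval _) (fun h hh i => hgd i h hh) h hh h
      have h2 : HasDerivAt (fun t : ℝ => vol (P u S (h + t • h))) (((d:ℝ)+1) * vol (P u S h)) 0 := by
        have h3 : HasDerivAt (fun t : ℝ => (1 + t) ^ (d+1) * vol (P u S h)) (((d:ℝ)+1) * vol (P u S h)) 0 := by
          have := (((hasDerivAt_id (0:ℝ)).const_add 1).pow (d+1)).mul_const (vol (P u S h))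
          refine HasDerivAt.congr_deriv (f := fun t : ℝ => (1 + t) ^ (d+1) * vol (P u S h)) this ?_
          simp
        refine h3.congr_of_eventuallyEq ?_
        have : ∀ᶠ t : ℝ in nhds 0, -1 < t := lt_mem_nhds (by norm_num)
        filter_upwards [this] with t ht
        rw [← vol_smul u S h (1+t) (by linarith), add_smul, one_smul]
      have h4 := h1.unique h2
      simp only [MvPolynomial.smul_eval, map_sum, map_mul, MvPolynomial.eval_X]
      rw [h4]; field_simp

lemma Rep.D_eq {u : J → Fin d → ℝ} {S : Finset J} {C : Set (J → ℝ)} (G : Good u S C) {f : MvPolynomial J ℝ}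
    (hf : Rep u S C f) (v : J → ℝ) (g : MvPolynomial J ℝ)
    (hg : ∀ h ∈ C, HasDerivAt (fun t : ℝ => vol (P u S (h + t • v))) (MvPolynomial.eval h g) 0) :
    D v f = g := by
  apply eq_of_open G.op G.ne
  intro h hh
  have h1 := hasDerivAt_eval f h v 0
  simp only [zero_smul, add_zero] at h1
  refine h1.unique ((hg h hh).congr_of_eventuallyEq ?_)
  filter_upwards [near_mem G.op hh v] with t ht
  exact (hf.2 _ ht).symm

lemma Rep.D_act {u : J → Fin (d+1) → ℝ} {S : Finset J} {C : Set (J → ℝ)} (G : Good u S C) {f : MvPolynomial J ℝ}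
    (hf : Rep u S C f) {h0 : J → ℝ} (hh0 : h0 ∈ C) {i : J} (ha : Good.Act u S h0 i) (k : Fin (d+1)) (hk : u i k ≠ 0)
    {fi : MvPolynomial J ℝ} (hfi : Rep (fu u i k) (S.erase i) (Lm i (fc u i k) '' C) fi) :
    D (Pi.single i 1) f = |u i k|⁻¹ • sub i (fc u i k) fi :=
  hf.D_eq G _ _ fun h hh => vol_deriv_act G ha.1 k hk fi (fun g hg => hfi.2 _ ⟨g, hg, rfl⟩)
            (fun g hg => P_compact _ _ (G.facet hh0 ha k hk).recc _) hh

lemma Rep.D_nonact {u : J → Fin d → ℝ} {S : Finset J} {C : Set (J → ℝ)} (G : Good u S C) {f : MvPolynomial J ℝ}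
    (hf : Rep u S C f) {h0 : J → ℝ} (hh0 : h0 ∈ C) {i : J} (ha : ¬ Good.Act u S h0 i) :
    D (Pi.single i 1) f = 0 :=
  hf.D_eq G _ _ fun h hh => by simpa using vol_deriv_nonact G hh (fun h' => ha (G.act_const hh hh0 h'))

lemma Rep.D_trans {u : J → Fin d → ℝ} {S : Finset J} {C : Set (J → ℝ)} (G : Good u S C) {f : MvPolynomial J ℝ}
    (hf : Rep u S C f) (v : Fin d → ℝ) : D (fun j => u j ⬝ᵥ v) f = 0 :=
  hf.D_eq G _ _ fun h hh => by
    have : (fun t : ℝ => vol (P u S (h + t • fun j => u j ⬝ᵥ v))) = fun t => vol (P u S h) := by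
      funext t
      have e : (h + t • fun j => u j ⬝ᵥ v) = fun j => h j + u j ⬝ᵥ (t • v) := by
        ext j; simp [dotProduct_smul]
      rw [e, P_trans, vol, measure_vadd, vol]
    rw [this]; simpa using hasDerivAt_const (0:ℝ) (vol (P u S h))

end Der
end AF



namespace AF

section AFG
variable {J : Type} [Fintype J] [DecidableEq J]
variable {d : ℕ}

lemma M_cons (v : J → ℝ) (l) (f : MvPolynomial J ℝ) : M (v :: l) f = M l (D v f) := by
  rw [M, M, DL_cons, DL_D]

lemma M_smul' (l) (a : ℝ) (f : MvPolynomial J ℝ) : M l (a • f) = a * M l f := by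
  rw [M, DL_smul, MvPolynomial.smul_eval, M]

lemma M_zero (l) : M l (0 : MvPolynomial J ℝ) = 0 := by
  have := M_smul' l 0 (0 : MvPolynomial J ℝ)
  simpa using this

variable {u : J → Fin d → ℝ} {S : Finset J} {C : Set (J → ℝ)} 

lemma pos_trans (G : Good u S C) {h : J → ℝ} (hh : h ∈ C) : ∃ h' ∈ C, (∀ j ∈ S, 0 < h' j) ∧
    ∀ f, Rep u S C f → ∀ l, M (h' :: l) f = M (h :: l) f := by
  obtain ⟨x, hx⟩ := G.exists_strict hh
  refine ⟨_, G.trans h hh (-x), fun j hj => ?_, fun f hf l => ?_⟩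
  · simp; exact hx j hj
  · rw [M_cons, M_cons]
    congr 1
    have := D_add h (fun j => u j ⬝ᵥ (-x)) f
    rw [hf.D_trans G, add_zero] at this
    exact this

lemma M_act {u : J → Fin (d+1) → ℝ} (G : Good u S C) {f : MvPolynomial J ℝ}
    (hf : Rep u S C f) {h0 : J → ℝ} (hh0 : h0 ∈ C) {i : J} (ha : Good.Act u S h0 i) (k : Fin (d+1)) (hk : u i k ≠ 0)
    {fi : MvPolynomial J ℝ} (hfi : Rep (fu u i k) (S.erase i) (Lm i (fc u i k) '' C) fi) (l) :
    M (Pi.single i 1 :: l) f = |u i k|⁻¹ * M (l.map (Lm i (fc u i k))) fi := by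
  rw [M_cons, hf.D_act G hh0 ha k hk hfi, M_smul', M_sub]

lemma M_nonact (G : Good u S C) {f : MvPolynomial J ℝ}
    (hf : Rep u S C f) {h0 : J → ℝ} (hh0 : h0 ∈ C) {i : J} (ha : ¬ Good.Act u S h0 i) (l) :
    M (Pi.single i 1 :: l) f = 0 := by
  rw [M_cons, hf.D_nonact G hh0 ha, M_zero]

theorem M_pos : ∀ {d : ℕ} {u : J → Fin d → ℝ} {S : Finset J} {C : Set (J → ℝ)} (G : Good u S C)
    {f : MvPolynomial J ℝ} (hf : Rep u S C f) (l : List (J → ℝ)) (hl : l.length = d)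
    (hlC : ∀ h ∈ l, h ∈ C), 0 < M l f := by
  classical
  intro d
  induction d with
  | zero =>
    intro u S C G f hf l hl hlC
    rw [List.length_eq_zero_iff] at hl
    subst hl
    obtain ⟨h, hh⟩ := G.ne
    have h1 := G.vol_pos hh
    rw [hf.2 h hh] at h1
    have h2 : f.totalDegree = 0 := Nat.le_zero.mp hf.1.totalDegree_le
    rw [MvPolynomial.totalDegree_eq_zero_iff_eq_C] at h2
    rw [h2] at h1 ⊢
    simpa [M] using h1
  | succ d ih =>
    intro u S C G f hf l hl hlC
    obtain ⟨h, l', rfl⟩ : ∃ h l', l = h :: l' := by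
      cases l with
      | nil => simp at hl
      | cons h l' => exact ⟨h, l', rfl⟩
    have hh := hlC h (by simp)
    have hl' : l'.length = d := by simpa using hl
    obtain ⟨h', hh', hpos, hM⟩ := pos_trans G hh
    rw [← hM f hf l', M_sum]
    have hact : ∀ i, Good.Act u S h' i → 0 < M (Pi.single i 1 :: l') f := by
      intro i ha
      obtain ⟨k, hk⟩ := G.act_ne_zero hh' ha
      have Gi := G.facet hh' ha k hk
      obtain ⟨fi, hfi⟩ := exists_rep Gi
      rw [M_act G hf hh' ha k hk hfi]
      have := ih Gi hfi (l'.map (Lm i (fc u i k))) (by simpa using hl') (by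
        intro g hg
        obtain ⟨g', hg', rfl⟩ := List.mem_map.mp hg
        exact ⟨g', hlC g' (by simp [hg']), rfl⟩)
      positivity
    have hex : ∃ i, Good.Act u S h' i := by
      by_contra hn
      push Not at hn
      have he := hf.1.sum_X_mul_pderiv
      have h0 : ∀ i, MvPolynomial.pderiv i f = 0 := fun i => by
        rw [← D_single, hf.D_nonact G hh' (hn i)]
      simp only [h0, mul_zero, Finset.sum_const_zero] at he
      have h1 := G.vol_pos hh
      rw [hf.2 h hh] at h1
      have h2 := congrArg (MvPolynomial.eval h) he
      simp at h2
      rcases h2 with h2 | h2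
      · have : (d:ℝ) + 1 ≠ 0 := by positivity
        exact this h2
      · linarith
    obtain ⟨i0, hi0⟩ := hex
    apply Finset.sum_pos'
    · intro i _
      by_cases ha : Good.Act u S h' i
      · exact mul_nonneg (hpos i ha.1).le (hact i ha).le
      · rw [M_nonact G hf hh' ha]; simp
    · exact ⟨i0, Finset.mem_univ _, mul_pos (hpos i0 hi0.1) (hact i0 hi0)⟩

lemma M_single_pos {u : J → Fin (d+1) → ℝ} (G : Good u S C) {f : MvPolynomial J ℝ}
    (hf : Rep u S C f) {h0 : J → ℝ} (hh0 : h0 ∈ C) {i : J} (ha : Good.Act u S h0 i) (l : List (J → ℝ))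
    (hl : l.length = d) (hlC : ∀ h ∈ l, h ∈ C) : 0 < M (Pi.single i 1 :: l) f := by
  obtain ⟨k, hk⟩ := G.act_ne_zero hh0 ha
  have Gi := G.facet hh0 ha k hk
  obtain ⟨fi, hfi⟩ := exists_rep Gi
  rw [M_act G hf hh0 ha k hk hfi]
  have := M_pos Gi hfi (l.map (Lm i (fc u i k))) (by simpa using hl) (by
    intro g hg
    obtain ⟨g', hg', rfl⟩ := List.mem_map.mp hg
    exact ⟨g', hlC g' hg', rfl⟩)
  positivity

/-- facets graph is connected -/
lemma facets_conn {u : J → Fin d → ℝ} (hd : 2 ≤ d) (G : Good u S C) {h : J → ℝ} (hh : h ∈ C)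
    (hpos : ∀ j ∈ S, 0 < h j) (T : Set {i // Good.Act u S h i}) (hT : T.Nonempty) (hT' : Tᶜ.Nonempty) :
    ∃ i ∈ T, ∃ j ∈ Tᶜ, ∃ x ∈ P u S h, u i.1 ⬝ᵥ x = h i.1 ∧ u j.1 ⬝ᵥ x = h j.1 := by
  classical
  let X : Set {i // Good.Act u S h i} → Set (Fin d → ℝ) := fun T =>
    ⋃ i ∈ T, ⋂ j ∈ S, {x | u j ⬝ᵥ x / h j ≤ u i.1 ⬝ᵥ x / h i.1}
  have hXc : ∀ T, IsClosed (X T) := by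
    intro T
    apply Set.Finite.isClosed_biUnion (Set.toFinite T)
    intro i _
    exact isClosed_biInter fun j _ => isClosed_le ((cont_dot _).div_const _) ((cont_dot _).div_const _)
  have hmem : ∀ T x, x ∈ X T ↔ ∃ i ∈ T, ∀ j ∈ S, u j ⬝ᵥ x / h j ≤ u i.1 ⬝ᵥ x / h i.1 := by
    intro T x; simp [X]
  have hmax : ∀ x : Fin d → ℝ, x ≠ 0 → ∀ i ∈ S, (∀ j ∈ S, u j ⬝ᵥ x / h j ≤ u i ⬝ᵥ x / h i) →
      0 < u i ⬝ᵥ x / h i ∧ ((u i ⬝ᵥ x / h i)⁻¹ • x ∈ P u S h) := by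
    intro x hx i hi hm
    have h1 : 0 < u i ⬝ᵥ x / h i := by
      by_contra hn
      push Not at hn
      apply hx
      apply G.recc
      intro j hj
      have := (hm j hj).trans hn
      rw [div_le_iff₀ (hpos j hj)] at this
      simpa using this
    refine ⟨h1, fun j hj => ?_⟩
    rw [dotProduct_smul, smul_eq_mul, inv_mul_le_iff₀ h1]
    have := hm j hj
    rwa [div_le_iff₀ (hpos j hj)] at this
  have hconn : IsPreconnected ({0}ᶜ : Set (Fin d → ℝ)) :=
    (isConnected_compl_singleton_of_one_lt_rank (by
      rw [rank_fin_fun]; exact_mod_cast (by omega : 1 < d)) 0).isPreconnected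
  have hne : ∀ T : Set {i // Good.Act u S h i}, T.Nonempty → (({0}ᶜ : Set (Fin d → ℝ)) ∩ X T).Nonempty := by
    rintro T ⟨⟨i, hi, x, hx, hxi⟩, hiT⟩
    refine ⟨x, ?_, (hmem _ _).mpr ⟨_, hiT, fun j hj => ?_⟩⟩
    · rintro rfl
      simp at hxi
      exact (hpos i hi).ne hxi
    · simp only
      rw [hxi, div_self (hpos i hi).ne', div_le_one (hpos j hj)]
      exact hx j hj
  have hcov : ({0}ᶜ : Set (Fin d → ℝ)) ⊆ X T ∪ X Tᶜ := by
    intro x hx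
    have hSne : S.Nonempty := by
      obtain ⟨⟨i, hi⟩, _⟩ := hT
      exact ⟨i, hi.1⟩
    obtain ⟨i, hi, hm⟩ := Finset.exists_max_image S (fun j => u j ⬝ᵥ x / h j) hSne
    obtain ⟨h1, h2⟩ := hmax x hx i hi hm
    have ha : Good.Act u S h i := ⟨hi, _, h2, by
      rw [dotProduct_smul, smul_eq_mul, inv_div]
      have h3 : u i ⬝ᵥ x ≠ 0 := by
        intro e; simp [e] at h1
      field_simp⟩
    by_cases hT : (⟨i, ha⟩ : {i // Good.Act u S h i}) ∈ T
    · left; exact (hmem _ _).mpr ⟨_, hT, hm⟩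
    · right; exact (hmem _ _).mpr ⟨_, hT, hm⟩
  obtain ⟨x, hx0, hx1, hx2⟩ := isPreconnected_closed_iff.mp hconn _ _ (hXc T) (hXc Tᶜ) hcov (hne T hT) (hne _ hT')
  obtain ⟨i, hiT, hi⟩ := (hmem _ _).mp hx1
  obtain ⟨j, hjT, hj⟩ := (hmem _ _).mp hx2
  obtain ⟨h1, h2⟩ := hmax x hx0 i.1 i.2.1 hi
  have e : u i.1 ⬝ᵥ x / h i.1 = u j.1 ⬝ᵥ x / h j.1 := le_antisymm (hj _ i.2.1) (hi _ j.2.1)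
  have aux : ∀ a : ℝ, ∀ q : ℝ, 0 < q → 0 < a / q → (a / q)⁻¹ * a = q := by
    intro a q hq haq
    have : a ≠ 0 := by rintro rfl; simp at haq
    field_simp
  refine ⟨i, hiT, j, hjT, _, h2, ?_, ?_⟩
  · rw [dotProduct_smul, smul_eq_mul, aux _ _ (hpos _ i.2.1) h1]
  · rw [dotProduct_smul, smul_eq_mul, e, aux _ _ (hpos _ j.2.1) (e ▸ h1)]

lemma af_base {u : J → Fin 2 → ℝ} (G : Good u S C) {f : MvPolynomial J ℝ} (hf : Rep u S C f)
    (g b : J → ℝ) (hb : b ∈ C) : M [g, g] f * M [b, b] f ≤ M [g, b] f ^ 2 := by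
  have hpol : ∀ a b : J → ℝ, M [a, b] f = MvPolynomial.eval (a + b) f - MvPolynomial.eval a f - MvPolynomial.eval b f := by
    intro a b
    have h1 := polarize f hf.1 ![a, b]
    have h0 : MvPolynomial.constantCoeff f = 0 := by
      exact hf.1.coeff_eq_zero (by simp)
    have e : (Finset.univ : Finset (Finset (Fin 2))) = {∅, {0}, {1}, {0, 1}} := by decide
    rw [e] at h1
    rw [Finset.sum_insert (by decide), Finset.sum_insert (by decide), Finset.sum_insert (by decide), Finset.sum_singleton] at h1
    simp [h0] at h1
    rw [← h1]; ring
  have hsq : ∀ a ∈ C, M [a, a] f = 2 * vol (P u S a) := by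
    intro a ha
    rw [hpol, ← two_smul ℝ a, ← hf.2 _ (G.cone a ha 2 two_pos), ← hf.2 a ha, vol_smul _ _ _ _ two_pos]
    ring
  have hmain : ∀ a ∈ C, M [a, a] f * M [b, b] f ≤ M [a, b] f ^ 2 := by
    intro a ha
    have hab : a + b ∈ C := by
      have := G.cone _ (G.cv ha hb (a := 1/2) (b := 1/2) (by norm_num) (by norm_num) (by norm_num)) 2 two_pos
      rw [smul_add, smul_smul, smul_smul] at this
      simpa using this
    have ha0 := G.vol_pos ha
    have hb0 := G.vol_pos hb
    have h1 := bm2 (P_compact u S G.recc a) (P_compact u S G.recc b) ha0 hb0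
    have h2 : vol (P u S a + P u S b) ≤ vol (P u S (a + b)) :=
      ENNReal.toReal_mono (P_compact u S G.recc _).measure_lt_top.ne (measure_mono (P_add u S a b))
    rw [hsq a ha, hsq b hb, hpol, ← hf.2 _ ha, ← hf.2 _ hb, ← hf.2 _ hab]
    have h3 : 2 * √(vol (P u S a) * vol (P u S b)) ≤ vol (P u S (a + b)) - vol (P u S a) - vol (P u S b) := by linarith
    calc _ = (2 * √(vol (P u S a) * vol (P u S b))) ^ 2 := by
          rw [mul_pow, Real.sq_sqrt (by positivity)]; ring
      _ ≤ _ := by gcongr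
  obtain ⟨t, ht, ht0⟩ : ∃ t : ℝ, b + t • g ∈ C ∧ 0 < t := by
    have := (near_mem G.op hb g).filter_mono (nhdsWithin_le_nhds (s := Set.Ioi 0))
    exact (this.and self_mem_nhdsWithin).exists
  have h1 := hmain _ ht
  have e1 : M [b + t • g, b] f = M [b, b] f + t * M [g, b] f := by rw [M_add, M_smul]
  have e2 : M [b + t • g, b + t • g] f = M [b, b] f + 2 * t * M [g, b] f + t ^ 2 * M [g, g] f := by
    rw [M_add, M_smul, M_swap b, M_swap g, M_add, M_add, M_smul, M_smul, M_swap b g]; ring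
  rw [e1, e2] at h1
  have : t ^ 2 * (M [g, g] f * M [b, b] f) ≤ t ^ 2 * M [g, b] f ^ 2 := by nlinarith
  exact le_of_mul_le_mul_left this (by positivity)

end AFG
end AF



namespace AF

section AFS
variable {J : Type} [Fintype J] [DecidableEq J]

set_option maxHeartbeats 1000000 in
lemma af_step {m : ℕ} 
    (ih : ∀ {u : J → Fin (m+2) → ℝ} {S : Finset J} {C : Set (J → ℝ)} (G : Good u S C)
      {f : MvPolynomial J ℝ} (hf : Rep u S C f) (g b : J → ℝ) (hb : b ∈ C) (l : List (J → ℝ)) (hl : l.length = m)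
      (hlC : ∀ h ∈ l, h ∈ C), M (g :: g :: l) f * M (b :: b :: l) f ≤ M (g :: b :: l) f ^ 2)
    {u : J → Fin (m+3) → ℝ} {S : Finset J} {C : Set (J → ℝ)} (G : Good u S C)
    {f : MvPolynomial J ℝ} (hf : Rep u S C f) (h : J → ℝ) (hh : h ∈ C) (hpos : ∀ j ∈ S, 0 < h j)
    (l : List (J → ℝ)) (hl : l.length = m) (hlC : ∀ h ∈ l, h ∈ C)
    (v : J → ℝ) (hv : M (v :: h :: h :: l) f = 0) : M (v :: v :: h :: l) f ≤ 0 := by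
  classical
  let I := {i // Good.Act u S h i}
  have hsum : ∀ v : J → ℝ, ∀ l, M (v :: l) f = ∑ i : I, v i.1 * M (Pi.single i.1 1 :: l) f := by
    intro v l
    rw [M_sum, ← Finset.sum_subtype (Finset.univ.filter (fun i => Good.Act u S h i)) (by simp) (fun i => v i * M (Pi.single i 1 :: l) f)]
    · rw [Finset.sum_filter]
      apply Finset.sum_congr rfl
      intro i _
      split_ifs with ha
      · rfl
      · rw [M_nonact G hf hh ha]; simp
  have hlC' : ∀ g ∈ h :: l, g ∈ C := by
    intro g hg
    rcases List.mem_cons.mp hg with rfl | hg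
    · exact hh
    · exact hlC g hg
  have hq : ∀ i : I, 0 < M (Pi.single i.1 1 :: h :: h :: l) f := by
    intro i
    apply M_single_pos G hf hh i.2
    · simp [hl]
    · intro g hg
      rcases List.mem_cons.mp hg with rfl | hg
      · exact hh
      · exact hlC' g hg
  have hhp : ∀ i : I, 0 < h i.1 := fun i => hpos i.1 i.2.1
  let A : I → I → ℝ := fun i j => M (Pi.single i.1 1 :: Pi.single j.1 1 :: h :: l) f
  have hrow : ∀ (x : J → ℝ) (i : I), ∑ j : I, A i j * x j.1 = M (Pi.single i.1 1 :: x :: h :: l) f := by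
    intro x i
    rw [M_swap, hsum]
    apply Finset.sum_congr rfl
    intro j _
    rw [M_swap, mul_comm]
  have hoff : ∀ i j : I, i ≠ j → 0 ≤ A i j ∧ ((∃ x ∈ P u S h, u i.1 ⬝ᵥ x = h i.1 ∧ u j.1 ⬝ᵥ x = h j.1) → 0 < A i j) := by
    intro i j hij
    have hij' : j.1 ≠ i.1 := fun e => hij (Subtype.ext e.symm)
    obtain ⟨k, hk⟩ := G.act_ne_zero hh i.2
    have Gi := G.facet hh i.2 k hk
    obtain ⟨fi, hfi⟩ := exists_rep Gi
    have e1 : Lm i.1 (fc u i.1 k) (Pi.single j.1 1) = Pi.single j.1 1 := by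
      ext a; simp [Lm, Pi.single_eq_of_ne hij'.symm]
    have e2 : A i j = |u i.1 k|⁻¹ * M (Pi.single j.1 1 :: (h :: l).map (Lm i.1 (fc u i.1 k))) fi := by
      show M _ f = _
      rw [M_act G hf hh i.2 k hk hfi, List.map_cons, e1]
    have hLh : Lm i.1 (fc u i.1 k) h ∈ Lm i.1 (fc u i.1 k) '' C := ⟨h, hh, rfl⟩
    have hp : Good.Act (fu u i.1 k) (S.erase i.1) (Lm i.1 (fc u i.1 k) h) j.1 → 0 < A i j := by
      intro ha
      rw [e2]
      have := M_single_pos Gi hfi hLh ha ((h :: l).map (Lm i.1 (fc u i.1 k))) (by simp [hl]) (by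
        intro g hg
        obtain ⟨g', hg', rfl⟩ := List.mem_map.mp hg
        exact ⟨g', hlC' g' hg', rfl⟩)
      exact mul_pos (inv_pos.mpr (abs_pos.mpr hk)) this
    constructor
    · by_cases ha : Good.Act (fu u i.1 k) (S.erase i.1) (Lm i.1 (fc u i.1 k) h) j.1
      · exact (hp ha).le
      · rw [e2, M_nonact Gi hfi hLh ha]; simp
    · rintro ⟨x, hx, hxi, hxj⟩
      apply hp
      refine ⟨Finset.mem_erase.mpr ⟨hij', j.2.1⟩, fun a => x (k.succAbove a), ?_, ?_⟩
      · rw [← mem_facet u i.1 k hk S h, ← hxi, sec_self u i.1 k hk]; exact hx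
      · rw [sec_dot_succ u i.1 k hk, hxi, hxj]
        simp [Lm, fc, hij']
  have hfacet : ∀ (g : J → ℝ) (i : I), h i.1 * M (Pi.single i.1 1 :: g :: g :: l) f ≤
      M (Pi.single i.1 1 :: g :: h :: l) f ^ 2 / (M (Pi.single i.1 1 :: h :: h :: l) f / h i.1) := by
    intro g i
    obtain ⟨k, hk⟩ := G.act_ne_zero hh i.2
    have Gi := G.facet hh i.2 k hk
    obtain ⟨fi, hfi⟩ := exists_rep Gi
    have hLh : Lm i.1 (fc u i.1 k) h ∈ Lm i.1 (fc u i.1 k) '' C := ⟨h, hh, rfl⟩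
    have h1 := ih Gi hfi (Lm i.1 (fc u i.1 k) g) _ hLh (l.map (Lm i.1 (fc u i.1 k))) (by simp [hl]) (by
        intro g hg
        obtain ⟨g', hg', rfl⟩ := List.mem_map.mp hg
        exact ⟨g', hlC g' hg', rfl⟩)
    have hw : 0 < |u i.1 k|⁻¹ := by positivity
    have key : M (Pi.single i.1 1 :: g :: g :: l) f * M (Pi.single i.1 1 :: h :: h :: l) f ≤
        M (Pi.single i.1 1 :: g :: h :: l) f ^ 2 := by
      rw [M_act G hf hh i.2 k hk hfi, M_act G hf hh i.2 k hk hfi, M_act G hf hh i.2 k hk hfi]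
      simp only [List.map_cons]
      have := mul_le_mul_of_nonneg_left h1 (sq_nonneg (|u i.1 k|⁻¹))
      nlinarith
    have h3 := hq i
    have h4 := hhp i
    rw [div_div_eq_mul_div, le_div_iff₀ h3]
    nlinarith
  have := bochner A (fun i j => M_swap _ _ _ _) (fun i => h i.1)
    (fun i => M (Pi.single i.1 1 :: h :: h :: l) f / h i.1) hhp (fun i => div_pos (hq i) (hhp i))
    (fun i => by rw [hrow h i, div_mul_cancel₀ _ (hhp i).ne'])
    (fun i j hij => (hoff i j hij).1)
    (fun T hT hT' => by
      obtain ⟨i, hi, j, hj, x, hx⟩ := facets_conn (by omega) G hh hpos T hT hT'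
      exact ⟨i, hi, j, hj, (hoff i j (fun e => hj (e ▸ hi))).2 ⟨x, hx⟩⟩)
    (fun g => by
      let g' : J → ℝ := fun j => if ha : Good.Act u S h j then g ⟨j, ha⟩ else 0
      have hg' : ∀ i : I, g i = g' i.1 := fun i => by simp [g', i.2]
      simp only [hg', hrow]
      calc ∑ i : I, g' i.1 * M (Pi.single i.1 1 :: g' :: h :: l) f = M (g' :: g' :: h :: l) f := (hsum _ _).symm
        _ = M (h :: g' :: g' :: l) f := M_perm (by
            exact ((List.Perm.swap _ _ _).cons _).trans (List.Perm.swap _ _ _)) f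
        _ = ∑ i : I, h i.1 * M (Pi.single i.1 1 :: g' :: g' :: l) f := hsum _ _
        _ ≤ _ := Finset.sum_le_sum fun i _ => hfacet g' i)
    (fun i => v i.1) (by
      rw [← hv, hsum v]
      apply Finset.sum_congr rfl
      intro i _
      rw [div_mul_cancel₀ _ (hhp i).ne', mul_comm])
  simp only [hrow] at this
  rw [hsum]; exact this

theorem af_good : ∀ (m : ℕ) {u : J → Fin (m+2) → ℝ} {S : Finset J} {C : Set (J → ℝ)} (G : Good u S C)
      {f : MvPolynomial J ℝ} (hf : Rep u S C f) (g b : J → ℝ) (hb : b ∈ C) (l : List (J → ℝ)) (hl : l.length = m)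
      (hlC : ∀ h ∈ l, h ∈ C), M (g :: g :: l) f * M (b :: b :: l) f ≤ M (g :: b :: l) f ^ 2 := by
  intro m
  induction m with
  | zero =>
    intro u S C G f hf g b hb l hl hlC
    rw [List.length_eq_zero_iff] at hl
    subst hl
    exact af_base G hf g b hb
  | succ m ih =>
    intro u S C G f hf g b hb l hl hlC
    obtain ⟨h, l', rfl⟩ : ∃ h l', l = h :: l' := by
      cases l with
      | nil => simp at hl
      | cons h l' => exact ⟨h, l', rfl⟩
    have hh := hlC h (by simp)
    have hl' : l'.length = m := by simpa using hl
    obtain ⟨h', hh', hpos, hM⟩ := pos_trans G hh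
    have hperm : ∀ a b c : J → ℝ, M (a :: b :: c :: l') f = M (c :: a :: b :: l') f := fun a b c =>
      M_perm (((List.Perm.swap _ _ _).cons _).trans (List.Perm.swap _ _ _)) f
    have hM' : ∀ a b, M (a :: b :: h :: l') f = M (a :: b :: h' :: l') f := by
      intro a b
      rw [hperm, ← hM f hf, ← hperm]
    rw [hM', hM', hM']
    have hyp := af_step ih G hf h' hh' hpos l' hl' (fun a ha => hlC a (by simp [ha]))
    have hB : 0 < M (b :: b :: h' :: l') f := M_pos G hf _ (by simp [hl']) (by
      intro a ha
      simp only [List.mem_cons] at ha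
      rcases ha with rfl | rfl | rfl | ha
      · exact hb
      · exact hb
      · exact hh'
      · exact hlC a (by simp [ha]))
    have hs : 0 < M (b :: h' :: h' :: l') f := M_pos G hf _ (by simp [hl']) (by
      intro a ha
      simp only [List.mem_cons] at ha
      rcases ha with rfl | rfl | rfl | ha
      · exact hb
      · exact hh'
      · exact hh'
      · exact hlC a (by simp [ha]))
    set s := M (b :: h' :: h' :: l') f
    set t := M (g :: h' :: h' :: l') f with ht
    have h1 := hyp (s • g + (-t) • b) (by rw [M_add, M_smul, M_smul]; ring)
    rw [M_add, M_smul, M_smul, M_swap g, M_swap b, M_add, M_add, M_smul, M_smul, M_smul, M_smul, M_swap b g] at h1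
    set GG := M (g :: g :: h' :: l') f
    set BB := M (b :: b :: h' :: l') f
    set CC := M (g :: b :: h' :: l') f
    have h2 : s ^ 2 * (GG * BB) ≤ s ^ 2 * CC ^ 2 := by
      have h3 := mul_le_mul_of_nonneg_right h1 hB.le
      nlinarith [sq_nonneg (t * BB - s * CC)]
    exact le_of_mul_le_mul_left h2 (by positivity)

end AFS
end AF



namespace AF

section Polar
variable {J : Type} [Fintype J] [DecidableEq J] {n : ℕ}

lemma clm_dot (f : StrongDual ℝ (Fin n → ℝ)) : ∃ c : Fin n → ℝ, ∀ x, f x = c ⬝ᵥ x := by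
  refine ⟨fun l => f (Pi.single l 1), fun x => ?_⟩
  have : x = ∑ l, x l • Pi.single l (1:ℝ) := by
    ext j; simp [Finset.sum_apply, Pi.single_apply]
  conv_lhs => rw [this]
  simp [dotProduct, mul_comm]

lemma half_convex (c : Fin n → ℝ) (s : ℝ) : Convex ℝ {x : Fin n → ℝ | c ⬝ᵥ x ≤ s} := by
  intro a ha b hb p q hp hq hpq
  have h1 : c ⬝ᵥ a ≤ s := ha
  have h2 : c ⬝ᵥ b ≤ s := hb
  show c ⬝ᵥ (p • a + q • b) ≤ s
  simp only [dotProduct_add, dotProduct_smul, smul_eq_mul]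
  have : s = p * s + q * s := by rw [← add_mul, hpq, one_mul]
  rw [this]; gcongr

lemma ext_active (u : J → Fin n → ℝ) (S : Finset J) (h : J → ℝ) {x : Fin n → ℝ}
    (hx : x ∈ Set.extremePoints ℝ (P u S h)) (w : Fin n → ℝ)
    (hw : ∀ j ∈ S, u j ⬝ᵥ x = h j → u j ⬝ᵥ w = 0) : w = 0 := by
  have hxP := hx.1
  have key : ∀ w : Fin n → ℝ, (∀ j ∈ S, u j ⬝ᵥ x = h j → u j ⬝ᵥ w = 0) →
      ∃ ε : ℝ, 0 < ε ∧ ∀ t, 0 ≤ t → t ≤ ε → x + t • w ∈ P u S h := by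
    intro w hw
    obtain ⟨ε, hε, H⟩ := small_move u S h x w hxP
    refine ⟨ε, hε, fun t ht hte => ?_⟩
    have h1 : x + ε • w ∈ P u S h := by
      intro j hj
      by_cases e : u j ⬝ᵥ x = h j
      · rw [dotProduct_add, dotProduct_smul, hw j hj e, e]; simp
      · exact (H j hj e).le
    exact seg_mem (P_convex u S h) hxP h1 ht hte
  obtain ⟨e1, he1, H1⟩ := key w hw
  obtain ⟨e2, he2, H2⟩ := key (-w) (fun j hj e => by rw [dotProduct_neg, hw j hj e, neg_zero])
  set t := min e1 e2
  have ht : 0 < t := lt_min he1 he2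
  have a := H1 t ht.le (min_le_left _ _)
  have b := H2 t ht.le (min_le_right _ _)
  have hseg : x ∈ openSegment ℝ (x + t • w) (x + t • -w) := by
    refine ⟨1/2, 1/2, by norm_num, by norm_num, by norm_num, ?_⟩
    ext i; simp; ring
  have := hx.2 a b hseg
  have h3 : t • w = 0 := by simpa using this
  exact (smul_eq_zero.mp h3).resolve_left ht.ne'

lemma ext_finite (u : J → Fin n → ℝ) (S : Finset J) (h : J → ℝ) :
    (Set.extremePoints ℝ (P u S h)).Finite := by
  classical
  apply Set.Finite.of_finite_image (f := fun x => S.filter (fun j => u j ⬝ᵥ x = h j)) (Set.toFinite _)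
  intro x hx y hy hxy
  have := ext_active u S h hx (x - y) (fun j hj e => by
    have h1 : j ∈ S.filter (fun j => u j ⬝ᵥ x = h j) := by simp [hj, e]
    have hxy' : S.filter (fun j => u j ⬝ᵥ x = h j) = S.filter (fun j => u j ⬝ᵥ y = h j) := hxy
    rw [hxy'] at h1
    rw [dotProduct_sub, e, (Finset.mem_filter.mp h1).2, sub_self])
  exact sub_eq_zero.mp this

/-- finite polytopes are intersections of half spaces -/
lemma exists_normals {X : Set (Fin n → ℝ)} (hX : X.Finite) {x0 : Fin n → ℝ}
    (hx0 : x0 ∈ interior (convexHull ℝ X)) :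
    ∃ F : Finset (Fin n → ℝ), (∀ c ∈ F, c ≠ 0) ∧
      ∀ y, (∀ c ∈ F, ∃ x ∈ convexHull ℝ X, c ⬝ᵥ y ≤ c ⬝ᵥ x) → y ∈ convexHull ℝ X := by
  classical
  have hfin : Fintype X := hX.fintype
  let v : X → Fin n → ℝ := fun x => x.1 - x0
  have hcv : ∀ c : Fin n → ℝ, ∀ s : ℝ, (∀ x ∈ X, c ⬝ᵥ x ≤ s) → ∀ x ∈ convexHull ℝ X, c ⬝ᵥ x ≤ s := by
    intro c s H x hx
    exact convexHull_min (t := {x | c ⬝ᵥ x ≤ s}) (fun x hx => H x hx) (half_convex c s) hx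
  have hrec : ∀ c : Fin n → ℝ, (∀ j ∈ (Finset.univ : Finset X), v j ⬝ᵥ c ≤ 0) → c = 0 := by
    intro c hc
    have h1 := hcv c (c ⬝ᵥ x0) (fun x hx => by
      have := hc ⟨x, hx⟩ (Finset.mem_univ _)
      simp only [v, sub_dotProduct] at this
      rw [dotProduct_comm c, dotProduct_comm c]; linarith)
    have hc2 : Continuous (fun t : ℝ => x0 + t • c) := by fun_prop
    have : ∀ᶠ t in nhds (0:ℝ), x0 + t • c ∈ convexHull ℝ X :=
      hc2.continuousAt.eventually_mem (by simpa using mem_interior_iff_mem_nhds.mp hx0)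
    obtain ⟨t, ht, ht0⟩ := ((this.filter_mono (nhdsWithin_le_nhds (s := Set.Ioi 0))).and self_mem_nhdsWithin).exists
    have h2 := h1 _ ht
    rw [dotProduct_add, dotProduct_smul, smul_eq_mul] at h2
    have ht0' : 0 < t := ht0
    have h3 : c ⬝ᵥ c ≤ 0 := by
      by_contra hn
      push Not at hn
      nlinarith [mul_pos ht0' hn]
    have h4 : 0 ≤ c ⬝ᵥ c := Finset.sum_nonneg fun i _ => mul_self_nonneg _
    exact dotProduct_self_eq_zero.mp (le_antisymm h3 h4)
  have hcomp := P_compact v Finset.univ hrec (fun _ => 1)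
  have hE := ext_finite v Finset.univ (fun _ => 1)
  have hKM := closure_convexHull_extremePoints hcomp (P_convex v Finset.univ (fun _ => 1))
  refine ⟨hE.toFinset.erase 0, fun c hc => (Finset.mem_erase.mp hc).1, fun y hy => ?_⟩
  by_contra hyn
  obtain ⟨f, s, hfs, hsy⟩ := geometric_hahn_banach_closed_point (convex_convexHull ℝ X)
    (hX.isCompact_convexHull ℝ).isClosed hyn
  obtain ⟨c, hc⟩ := clm_dot f
  simp only [hc] at hfs hsy
  have hx0Q := interior_subset hx0
  have hδ : 0 < s - c ⬝ᵥ x0 := by linarith [hfs x0 hx0Q]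
  set δ := s - c ⬝ᵥ x0 with hδd
  have hmem : δ⁻¹ • c ∈ P v Finset.univ (fun _ => 1) := by
    intro x _
    have := hfs x.1 (subset_convexHull ℝ X x.2)
    rw [dotProduct_smul, smul_eq_mul, inv_mul_le_iff₀ hδ]
    simp only [v, sub_dotProduct]
    rw [dotProduct_comm _ c, dotProduct_comm _ c]; linarith
  rw [← hKM] at hmem
  have hsub : closure (convexHull ℝ (Set.extremePoints ℝ (P v Finset.univ (fun _ => (1:ℝ))))) ⊆ {e | (y - x0) ⬝ᵥ e ≤ 1} := by
    apply closure_minimal _ (isClosed_le (cont_dot _) continuous_const)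
    apply convexHull_min
    · intro e he
      show (y - x0) ⬝ᵥ e ≤ 1
      by_cases he0 : e = 0
      · subst he0; simp
      obtain ⟨x, hx, hyx⟩ := hy e (by simp [he0, he])
      have h1 := hcv e (1 + e ⬝ᵥ x0) (fun x hx => by
        have := he.1 ⟨x, hx⟩ (Finset.mem_univ _)
        simp only [v, sub_dotProduct] at this
        rw [dotProduct_comm e, dotProduct_comm e]; linarith) x hx
      rw [sub_dotProduct, dotProduct_comm, dotProduct_comm x0]; linarith
    · exact half_convex _ _
  have h5 := hsub hmem
  simp only [Set.mem_setOf_eq, dotProduct_smul, smul_eq_mul] at h5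
  rw [inv_mul_le_iff₀ hδ, sub_dotProduct, dotProduct_comm, dotProduct_comm x0] at h5
  linarith

end Polar
end AF



namespace AF

section Gen
variable {J : Type} [Fintype J] [DecidableEq J] {n : ℕ}

def Ub (u : J → Fin n → ℝ) (b : Fin n → J) : Matrix (Fin n) (Fin n) ℝ := Matrix.of fun k => u (b k)

noncomputable def xb (u : J → Fin n → ℝ) (b : Fin n → J) : (J → ℝ) →ₗ[ℝ] (Fin n → ℝ) :=
  (Matrix.toLin' (Ub u b)⁻¹) ∘ₗ LinearMap.funLeft ℝ ℝ b

lemma xb_apply (u : J → Fin n → ℝ) (b : Fin n → J) (h : J → ℝ) :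
    xb u b h = (Ub u b)⁻¹.mulVec (fun k => h (b k)) := rfl

noncomputable def el (u : J → Fin n → ℝ) (b : Fin n → J) (j : J) : (J → ℝ) →ₗ[ℝ] ℝ where
  toFun h := h j - u j ⬝ᵥ xb u b h
  map_add' h g := by simp only [map_add, dotProduct_add, Pi.add_apply]; ring
  map_smul' t h := by simp only [map_smul, dotProduct_smul, Pi.smul_apply, smul_eq_mul, RingHom.id_apply]; ring

lemma el_apply (u : J → Fin n → ℝ) (b : Fin n → J) (j : J) (h : J → ℝ) :
    el u b j h = h j - u j ⬝ᵥ xb u b h := rfl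

lemma xb_spec {u : J → Fin n → ℝ} {b : Fin n → J} (hb : IsUnit (Ub u b).det) (h : J → ℝ) (k : Fin n) :
    u (b k) ⬝ᵥ xb u b h = h (b k) := by
  have : (Ub u b).mulVec (xb u b h) = fun k => h (b k) := by
    rw [xb_apply, Matrix.mulVec_mulVec, Matrix.mul_nonsing_inv _ hb, Matrix.one_mulVec]
  exact congrFun this k

lemma xb_uniq {u : J → Fin n → ℝ} {b : Fin n → J} (hb : IsUnit (Ub u b).det) (h : J → ℝ) (x : Fin n → ℝ)
    (hx : ∀ k, u (b k) ⬝ᵥ x = h (b k)) : x = xb u b h := by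
  have : (fun k => h (b k)) = (Ub u b).mulVec x := by ext k; exact (hx k).symm
  rw [xb_apply, this, Matrix.mulVec_mulVec, Matrix.nonsing_inv_mul _ hb, Matrix.one_mulVec]

lemma exists_generic (u : J → Fin n → ℝ) : ∃ z : J → ℝ, ∀ b : Fin n → J, ∀ j, j ∉ Set.range b → el u b j z ≠ 0 := by
  obtain ⟨z, hz⟩ := Module.Dual.exists_forall_ne_zero_of_forall_exists (K := ℝ) (M := J → ℝ)
    (fun i : {p : (Fin n → J) × J // p.2 ∉ Set.range p.1} => el u i.1.1 i.1.2) (by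
      rintro ⟨⟨b, j⟩, hj⟩
      refine ⟨Pi.single j 1, ?_⟩
      have : (fun k => (Pi.single j 1 : J → ℝ) (b k)) = 0 := by
        ext k
        have : b k ≠ j := fun e => hj ⟨k, e⟩
        simp [Pi.single_apply, this]
      rw [el_apply, xb_apply, this]; simp)
  exact ⟨z, fun b j hj => hz ⟨(b, j), hj⟩⟩

structure Conf (u : J → Fin n → ℝ) (h0 : J → ℝ) : Prop where
  recc : ∀ x : Fin n → ℝ, (∀ j ∈ (Finset.univ : Finset J), u j ⬝ᵥ x ≤ 0) → x = 0
  gen : ∀ b : Fin n → J, ∀ j, j ∉ Set.range b → el u b j h0 ≠ 0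
  Pne : (P u Finset.univ h0).Nonempty

def BB (u : J → Fin n → ℝ) (h0 : J → ℝ) : Set (Fin n → J) :=
  {b | IsUnit (Ub u b).det ∧ ∀ j, j ∉ Set.range b → 0 < el u b j h0}

def CC (u : J → Fin n → ℝ) (h0 : J → ℝ) : Set (J → ℝ) :=
  {h | ∀ b ∈ BB u h0, ∀ j, j ∉ Set.range b → 0 < el u b j h}

def CK (u : J → Fin n → ℝ) (h0 : J → ℝ) : Set (J → ℝ) :=
  {h | ∀ b ∈ BB u h0, ∀ j, j ∉ Set.range b → 0 ≤ el u b j h}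

lemma max_ext {u : J → Fin n → ℝ} {S : Finset J} {h : J → ℝ} (hc : IsCompact (P u S h))
    (hne : (P u S h).Nonempty) (c : Fin n → ℝ) :
    ∃ x ∈ Set.extremePoints ℝ (P u S h), ∀ y ∈ P u S h, c ⬝ᵥ y ≤ c ⬝ᵥ x := by
  obtain ⟨x1, hx1, hmax⟩ := hc.exists_isMaxOn hne (cont_dot c).continuousOn
  have hm : ∀ y ∈ P u S h, c ⬝ᵥ y ≤ c ⬝ᵥ x1 := fun y hy => hmax hy
  set s := c ⬝ᵥ x1
  have hF : IsCompact (P u S h ∩ {y | s ≤ c ⬝ᵥ y}) :=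
    hc.inter_right (isClosed_le continuous_const (cont_dot c))
  obtain ⟨x, hx⟩ := hF.extremePoints_nonempty ⟨x1, hx1, le_refl (c ⬝ᵥ x1)⟩
  have hxs : s ≤ c ⬝ᵥ x := hx.1.2
  refine ⟨x, ⟨hx.1.1, ?_⟩, fun y hy => (hm y hy).trans hxs⟩
  intro a ha b hb hab
  have hab2 := hab
  obtain ⟨p, q, hp, hq, hpq, e⟩ := hab2
  have h1 := hm a ha
  have h2 := hm b hb
  have h3 : c ⬝ᵥ x = p * (c ⬝ᵥ a) + q * (c ⬝ᵥ b) := by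
    rw [← e, dotProduct_add, dotProduct_smul, dotProduct_smul]; rfl
  have hs : s = p * s + q * s := by rw [← add_mul, hpq, one_mul]
  have ha2 : s ≤ c ⬝ᵥ a := by
    by_contra hn; push Not at hn
    nlinarith [mul_lt_mul_of_pos_left hn hp, mul_le_mul_of_nonneg_left h2 hq.le]
  have hb2 : s ≤ c ⬝ᵥ b := by
    by_contra hn; push Not at hn
    nlinarith [mul_lt_mul_of_pos_left hn hq, mul_le_mul_of_nonneg_left h1 hp.le]
  exact hx.2 ⟨ha, ha2⟩ ⟨hb, hb2⟩ hab

lemma active_basis {u : J → Fin n → ℝ} {h : J → ℝ} {x : Fin n → ℝ}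
    (hx : x ∈ Set.extremePoints ℝ (P u Finset.univ h)) :
    ∃ b : Fin n → J, IsUnit (Ub u b).det ∧ ∀ k, u (b k) ⬝ᵥ x = h (b k) := by
  classical
  obtain ⟨κ, a, ha, hsp, hli⟩ := exists_linearIndependent' (K := ℝ) (fun j : {j : J // u j ⬝ᵥ x = h j} => u j.1)
  have htop : Submodule.span ℝ (Set.range (fun j : {j : J // u j ⬝ᵥ x = h j} => u j.1)) = ⊤ := by
    by_contra hn
    obtain ⟨f, hf0, hf⟩ := Submodule.exists_le_ker_of_lt_top _ (lt_top_iff_ne_top.mpr hn)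
    obtain ⟨c, hc⟩ := clm_dot (LinearMap.toContinuousLinearMap f)
    have : c = 0 := ext_active u Finset.univ h hx c (fun j _ e => by
      have := hf (Submodule.subset_span ⟨⟨j, e⟩, rfl⟩)
      rw [LinearMap.mem_ker] at this
      rw [dotProduct_comm, ← hc]; exact this)
    apply hf0
    refine LinearMap.ext fun y => ?_
    have h5 := hc y
    rw [this, zero_dotProduct] at h5
    exact h5
  have B := Module.Basis.mk hli (by rw [hsp, htop])
  haveI : Fintype κ := Fintype.ofInjective a ha
  have hcard : Fintype.card κ = n := by
    rw [← Module.finrank_eq_card_basis B]; simp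
  let e := Fintype.equivFinOfCardEq hcard
  refine ⟨fun k => (a (e.symm k)).1, ?_, fun k => (a (e.symm k)).2⟩
  rw [← Matrix.isUnit_iff_isUnit_det]
  apply Matrix.linearIndependent_rows_iff_isUnit.mp
  exact hli.comp e.symm e.symm.injective

lemma Conf.K {u : J → Fin n → ℝ} {h0 : J → ℝ} (G : Conf u h0) (c : Fin n → ℝ) :
    ∃ b ∈ BB u h0, ∃ lam : Fin n → ℝ, (∀ k, 0 ≤ lam k) ∧ ∀ y, c ⬝ᵥ y = ∑ k, lam k * (u (b k) ⬝ᵥ y) := by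
  obtain ⟨x, hx, hmax⟩ := max_ext (P_compact u Finset.univ G.recc h0) G.Pne c
  obtain ⟨b, hb, hact⟩ := active_basis hx
  have hxb := xb_uniq hb h0 x hact
  have hpos : ∀ j, j ∉ Set.range b → 0 < el u b j h0 := by
    intro j hj
    refine lt_of_le_of_ne ?_ (G.gen b j hj).symm
    rw [el_apply, ← hxb]
    linarith [hx.1 j (Finset.mem_univ j)]
  refine ⟨b, ⟨hb, hpos⟩, fun k => c ⬝ᵥ (Ub u b)⁻¹.mulVec (Pi.single k 1), ?_, ?_⟩
  · intro k
    set w := (Ub u b)⁻¹.mulVec (Pi.single k 1) with hw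
    have huw : ∀ i, u (b i) ⬝ᵥ w = if i = k then 1 else 0 := by
      intro i
      have : (Ub u b).mulVec w = Pi.single k 1 := by
        rw [hw, Matrix.mulVec_mulVec, Matrix.mul_nonsing_inv _ hb, Matrix.one_mulVec]
      have := congrFun this i
      rw [Pi.single_apply] at this
      exact this
    obtain ⟨ε, hε, H⟩ := small_move u Finset.univ h0 x (-w) hx.1
    have hm : x + ε • -w ∈ P u Finset.univ h0 := by
      intro j hj
      by_cases e : u j ⬝ᵥ x = h0 j
      · have : j ∈ Set.range b := by
          by_contra hn
          have := hpos j hn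
          rw [el_apply, ← hxb] at this
          linarith
        obtain ⟨i, rfl⟩ := this
        rw [dotProduct_add, dotProduct_smul, dotProduct_neg, huw, e, smul_eq_mul]
        split_ifs <;> linarith
      · exact (H j hj e).le
    have := hmax _ hm
    rw [dotProduct_add, dotProduct_smul, dotProduct_neg, smul_eq_mul] at this
    by_contra hn
    push Not at hn
    nlinarith
  · intro y
    have : y = (Ub u b)⁻¹.mulVec (∑ k, (u (b k) ⬝ᵥ y) • Pi.single k (1:ℝ)) := by
      have e : (∑ k, (u (b k) ⬝ᵥ y) • Pi.single k (1:ℝ)) = (Ub u b).mulVec y := by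
        ext i; simp [Finset.sum_apply, Pi.single_apply, Ub, Matrix.mulVec]
      rw [e, Matrix.mulVec_mulVec, Matrix.nonsing_inv_mul _ hb, Matrix.one_mulVec]
    conv_lhs => rw [this]
    rw [Matrix.mulVec_sum, dotProduct_sum]
    refine Finset.sum_congr rfl fun k _ => ?_
    rw [Matrix.mulVec_smul, dotProduct_smul, smul_eq_mul, mul_comm]

lemma BB_mem_P {u : J → Fin n → ℝ} {h0 : J → ℝ} {b} (hb : b ∈ BB u h0) {h} (hh : h ∈ CK u h0) :
    xb u b h ∈ P u Finset.univ h := by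
  intro j _
  by_cases hj : j ∈ Set.range b
  · obtain ⟨k, rfl⟩ := hj
    exact (xb_spec hb.1 h k).le
  · have := hh b hb j hj
    rw [el_apply] at this; linarith

lemma Conf.K2 {u : J → Fin n → ℝ} {h0 : J → ℝ} (G : Conf u h0) (h : J → ℝ) :
    P u Finset.univ h ⊆ convexHull ℝ ((fun b => xb u b h) '' BB u h0) := by
  intro x hx
  by_contra hxn
  have hX : ((fun b => xb u b h) '' BB u h0).Finite := (Set.toFinite _).image _
  obtain ⟨f, s, hfs, hsy⟩ := geometric_hahn_banach_closed_point (convex_convexHull ℝ _)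
    (hX.isCompact_convexHull ℝ).isClosed hxn
  obtain ⟨c, hc⟩ := clm_dot f
  simp only [hc] at hfs hsy
  obtain ⟨b, hb, lam, hl, hcl⟩ := G.K c
  have h1 := hfs _ (subset_convexHull ℝ _ ⟨b, hb, rfl⟩)
  have h2 : c ⬝ᵥ x ≤ c ⬝ᵥ xb u b h := by
    rw [hcl, hcl]
    refine Finset.sum_le_sum fun k _ => mul_le_mul_of_nonneg_left ?_ (hl k)
    rw [xb_spec hb.1]; exact hx _ (Finset.mem_univ _)
  linarith

lemma CC_sub_CK (u : J → Fin n → ℝ) (h0 : J → ℝ) : CC u h0 ⊆ CK u h0 :=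
  fun h hh b hb j hj => (hh b hb j hj).le

lemma Conf.good {u : J → Fin n → ℝ} {h0 : J → ℝ} (G : Conf u h0) : Good u Finset.univ (CC u h0) where
  op := by
    have : CC u h0 = ⋂ b : Fin n → J, ⋂ j : J, {h | b ∈ BB u h0 → j ∉ Set.range b → 0 < el u b j h} := by
      ext h; simp only [CC, Set.mem_setOf_eq, Set.mem_iInter]
      exact ⟨fun H b j hb hj => H b hb j hj, fun H b hb j hj => H b j hb hj⟩
    rw [this]
    refine isOpen_iInter_of_finite fun b => isOpen_iInter_of_finite fun j => ?_
    by_cases hb : b ∈ BB u h0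
    · by_cases hj : j ∉ Set.range b
      · simp only [hb, hj, not_false_eq_true, forall_const]
        exact isOpen_lt continuous_const (LinearMap.continuous_of_finiteDimensional _)
      · simp only [hj, false_imp_iff, imp_true_iff]; exact isOpen_univ
    · simp [hb]
  cv := by
    intro h hh g hg p q hp hq hpq b hb j hj
    rw [map_add, map_smul, map_smul, smul_eq_mul, smul_eq_mul]
    have h1 := hh b hb j hj
    have h2 := hg b hb j hj
    rcases hp.eq_or_lt with rfl | hp
    · have : q = 1 := by linarith
      subst this; simpa using h2
    · have := mul_pos hp h1
      have := mul_nonneg hq h2.le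
      linarith
  cone := by
    intro h hh t ht b hb j hj
    rw [map_smul]; exact mul_pos ht (hh b hb j hj)
  trans := by
    intro h hh v b hb j hj
    have e : (fun j => h j + u j ⬝ᵥ v) = h + fun j => u j ⬝ᵥ v := rfl
    have e2 : v = xb u b (fun j => u j ⬝ᵥ v) := xb_uniq hb.1 _ _ (fun k => rfl)
    rw [e, map_add, el_apply u b j (fun j => u j ⬝ᵥ v), ← e2]
    have := hh b hb j hj
    linarith
  ne := ⟨h0, fun b hb j hj => hb.2 j hj⟩
  Pne := by
    intro h hh
    obtain ⟨b, hb, -⟩ := G.K 0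
    exact ⟨_, BB_mem_P hb (CC_sub_CK u h0 hh)⟩
  simple := by
    classical
    intro h hh x hx τ
    obtain ⟨b, hb, lam, hl, hcl⟩ := G.K (∑ j ∈ Finset.univ.filter (fun j => u j ⬝ᵥ x = h j), u j)
    have hP := BB_mem_P hb (CC_sub_CK u h0 hh)
    have h1 : (∑ j ∈ Finset.univ.filter (fun j => u j ⬝ᵥ x = h j), u j) ⬝ᵥ x ≤
        (∑ j ∈ Finset.univ.filter (fun j => u j ⬝ᵥ x = h j), u j) ⬝ᵥ xb u b h := by
      rw [hcl, hcl]
      refine Finset.sum_le_sum fun k _ => mul_le_mul_of_nonneg_left ?_ (hl k)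
      rw [xb_spec hb.1]; exact hx _ (Finset.mem_univ _)
    rw [sum_dotProduct, sum_dotProduct] at h1
    refine ⟨xb u b τ, fun j _ hj => ?_⟩
    have h2 : u j ⬝ᵥ xb u b h = h j := by
      by_contra hne
      have hlt : u j ⬝ᵥ xb u b h < h j := lt_of_le_of_ne (hP j (Finset.mem_univ j)) hne
      refine absurd h1 (not_le.mpr ?_)
      refine Finset.sum_lt_sum (fun i hi => ?_) ⟨j, by simp [hj], by rw [hj]; exact hlt⟩
      rw [(Finset.mem_filter.mp hi).2]; exact hP i (Finset.mem_univ i)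
    have h3 : j ∈ Set.range b := by
      by_contra hn
      have := hh b hb j hn
      rw [el_apply] at this; linarith
    obtain ⟨k, rfl⟩ := h3
    exact xb_spec hb.1 τ k
  recc := G.recc

end Gen
end AF



namespace AF

section Poly
variable {n : ℕ}

lemma finite_sum_sets {ι : Type} (T : Finset ι) (X : ι → Set (Fin n → ℝ)) (hX : ∀ i, (X i).Finite) :
    (∑ i ∈ T, X i).Finite := by
  classical
  induction T using Finset.induction_on with
  | empty => simp
  | insert a s ha ih => rw [Finset.sum_insert ha]; exact (hX a).add ih

lemma exists_conf (X : Fin n → Set (Fin n → ℝ)) (hX : ∀ i, (X i).Finite) (hne : ∀ i, (X i).Nonempty)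
    {x0 : Fin n → ℝ} (hx0 : x0 ∈ interior (∑ i, convexHull ℝ (X i))) :
    ∃ (J : Type) (_ : Fintype J) (_ : DecidableEq J) (u : J → Fin n → ℝ) (h0 : J → ℝ)
      (hh : Fin n → J → ℝ), Conf u h0 ∧ (∀ i, hh i ∈ CK u h0) ∧
      ∀ (σ : Fin n → Fin n) (T : Finset (Fin n)),
        ∑ i ∈ T, convexHull ℝ (X (σ i)) = P u Finset.univ (∑ i ∈ T, hh (σ i)) := by
  classical
  set Q : Fin n → Set (Fin n → ℝ) := fun i => convexHull ℝ (X i) with hQ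
  have hQs : ∑ i, Q i = convexHull ℝ (∑ i, X i) := (convexHull_sum _ _).symm
  have hx0' := hx0
  rw [show ∑ i, convexHull ℝ (X i) = convexHull ℝ (∑ i, X i) from hQs] at hx0'
  obtain ⟨F, hF0, hF⟩ := exists_normals (finite_sum_sets Finset.univ X hX) hx0'
  rw [← hQs] at hF
  have hQc : ∀ i, IsCompact (Q i) := fun i => (hX i).isCompact_convexHull ℝ
  have hmax : ∀ i, ∀ j : F, ∃ q ∈ Q i, ∀ y ∈ Q i, j.1 ⬝ᵥ y ≤ j.1 ⬝ᵥ q := fun i j => by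
    obtain ⟨q, hq, h⟩ := (hQc i).exists_isMaxOn (hne i).convexHull (cont_dot j.1).continuousOn
    exact ⟨q, hq, fun y hy => h hy⟩
  choose q hq hqm using hmax
  let u : F → Fin n → ℝ := fun j => j.1
  let hh : Fin n → F → ℝ := fun i j => j.1 ⬝ᵥ q i j
  have hhle : ∀ i, ∀ y ∈ Q i, ∀ j, u j ⬝ᵥ y ≤ hh i j := fun i y hy j => hqm i j y hy
  set hS : F → ℝ := ∑ i, hh i with hSd
  have hSle : ∀ y ∈ ∑ i, Q i, ∀ j, u j ⬝ᵥ y ≤ hS j := by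
    intro y hy j
    obtain ⟨g, hg, rfl⟩ := (Set.mem_fintype_sum _ _).mp hy
    rw [dotProduct_sum, hSd, Finset.sum_apply]
    exact Finset.sum_le_sum fun i _ => hhle i _ (hg i) j
  have hPQ : ∀ y, (∀ j, u j ⬝ᵥ y ≤ hS j) → y ∈ ∑ i, Q i := by
    intro y hy
    refine hF y fun c hc => ⟨∑ i, q i ⟨c, hc⟩, ?_, ?_⟩
    · exact (Set.mem_fintype_sum _ _).mpr ⟨_, fun i => hq i _, rfl⟩
    · have := hy ⟨c, hc⟩
      rw [hSd, Finset.sum_apply] at this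
      rw [dotProduct_sum]; exact this
  have hQcomp : IsCompact (∑ i, Q i) := by
    rw [hQs]; exact (finite_sum_sets Finset.univ X hX).isCompact_convexHull ℝ
  have hx0Q := interior_subset hx0
  have hstrict : ∀ j, u j ⬝ᵥ x0 < hS j := by
    intro j
    have hc2 : Continuous (fun t : ℝ => x0 + t • u j) := by fun_prop
    have : ∀ᶠ t in nhds (0:ℝ), x0 + t • u j ∈ ∑ i, Q i :=
      hc2.continuousAt.eventually_mem (by simpa using mem_interior_iff_mem_nhds.mp hx0)
    obtain ⟨t, ht, ht0⟩ := ((this.filter_mono (nhdsWithin_le_nhds (s := Set.Ioi 0))).and self_mem_nhdsWithin).exists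
    have ht0' : 0 < t := ht0
    have h2 := hSle _ ht j
    rw [dotProduct_add, dotProduct_smul, smul_eq_mul] at h2
    have h4 : 0 ≤ u j ⬝ᵥ u j := Finset.sum_nonneg fun i _ => mul_self_nonneg _
    have h5 : u j ⬝ᵥ u j ≠ 0 := fun e => hF0 j.1 j.2 (dotProduct_self_eq_zero.mp e)
    have := mul_pos ht0' (lt_of_le_of_ne h4 h5.symm)
    linarith
  have hrecc : ∀ x : Fin n → ℝ, (∀ j ∈ (Finset.univ : Finset F), u j ⬝ᵥ x ≤ 0) → x = 0 := by
    intro x hx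
    by_contra hne0
    have hmem : ∀ t : ℝ, 0 ≤ t → x0 + t • x ∈ ∑ i, Q i := by
      intro t ht
      refine hPQ _ fun j => ?_
      rw [dotProduct_add, dotProduct_smul, smul_eq_mul]
      have := mul_nonneg ht (neg_nonneg.mpr (hx j (Finset.mem_univ j)))
      linarith [hstrict j]
    obtain ⟨R, hR⟩ := hQcomp.isBounded.exists_norm_le
    have hR0 : 0 ≤ R := (norm_nonneg _).trans (hR _ hx0Q)
    have hxn : 0 < ‖x‖ := norm_pos_iff.mpr hne0
    have h1 := hR _ (hmem ((2 * R + 1) / ‖x‖) (by positivity))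
    have h2 : ‖((2 * R + 1) / ‖x‖) • x‖ = 2 * R + 1 := by
      rw [norm_smul, Real.norm_of_nonneg (by positivity)]; field_simp
    have h3 : ‖((2 * R + 1) / ‖x‖) • x‖ ≤ ‖x0 + ((2 * R + 1) / ‖x‖) • x‖ + ‖x0‖ := by
      have := norm_sub_le (x0 + ((2 * R + 1) / ‖x‖) • x) x0
      simpa using this
    linarith [hR _ hx0Q]
  obtain ⟨z, hz⟩ := exists_generic u
  have hev1 : ∀ b : Fin n → F, ∀ j, ∀ᶠ ε in nhdsWithin (0:ℝ) (Set.Ioi 0),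
      (el u b j hS < 0 → el u b j (hS + ε • z) < 0) ∧ (j ∉ Set.range b → el u b j (hS + ε • z) ≠ 0) := by
    intro b j
    have hcont : Filter.Tendsto (fun ε : ℝ => el u b j (hS + ε • z)) (nhdsWithin 0 (Set.Ioi 0)) (nhds (el u b j hS)) := by
      have : Continuous (fun ε : ℝ => el u b j (hS + ε • z)) := by
        simp only [map_add, map_smul, smul_eq_mul]; fun_prop
      have h := this.tendsto 0
      simp only [zero_smul, add_zero] at h
      exact h.mono_left nhdsWithin_le_nhds
    have e1 : ∀ᶠ ε in nhdsWithin (0:ℝ) (Set.Ioi 0), el u b j hS < 0 → el u b j (hS + ε • z) < 0 := by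
      by_cases h : el u b j hS < 0
      · filter_upwards [hcont.eventually_lt_const h] with ε hε _ using hε
      · simp [h]
    have e2 : ∀ᶠ ε in nhdsWithin (0:ℝ) (Set.Ioi 0), j ∉ Set.range b → el u b j (hS + ε • z) ≠ 0 := by
      by_cases h : el u b j hS = 0
      · filter_upwards [self_mem_nhdsWithin] with ε hε hj
        rw [map_add, map_smul, h, zero_add, smul_eq_mul]
        exact mul_ne_zero (ne_of_gt hε) (hz b j hj)
      · filter_upwards [hcont.eventually_ne h] with ε hε _ using hε
    exact e1.and e2
  have hev2 : ∀ j, ∀ᶠ ε in nhdsWithin (0:ℝ) (Set.Ioi 0), u j ⬝ᵥ x0 < (hS + ε • z) j := by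
    intro j
    have hcont : Continuous (fun ε : ℝ => (hS + ε • z) j) := by
      simp only [Pi.add_apply, Pi.smul_apply, smul_eq_mul]; fun_prop
    have h := (hcont.tendsto 0).mono_left (nhdsWithin_le_nhds (s := Set.Ioi 0))
    exact h.eventually_const_lt (by simpa using hstrict j)
  obtain ⟨ε, hε1, hε2⟩ := ((Filter.eventually_all.mpr fun b => Filter.eventually_all.mpr (hev1 b)).and
    (Filter.eventually_all.mpr hev2)).exists
  set h0 := hS + ε • z with hh0
  have hBS : ∀ b ∈ BB u h0, ∀ i, xb u b (hh i) ∈ Q i := by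
    intro b hb
    have h1 : xb u b hS ∈ ∑ i, Q i := by
      refine hPQ _ fun j => ?_
      by_cases hj : j ∈ Set.range b
      · obtain ⟨k, rfl⟩ := hj
        exact (xb_spec hb.1 hS k).le
      · by_contra hn
        push Not at hn
        have h2 := (hε1 b j).1 (by rw [el_apply]; linarith)
        linarith [hb.2 j hj]
    obtain ⟨p, hp, hps⟩ := (Set.mem_fintype_sum _ _).mp h1
    intro i
    have : p i = xb u b (hh i) := by
      refine xb_uniq hb.1 _ _ fun k => ?_
      have hsum : ∑ i, u (b k) ⬝ᵥ p i = ∑ i, hh i (b k) := by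
        rw [← dotProduct_sum, hps, xb_spec hb.1, hSd, Finset.sum_apply]
      exact (Finset.sum_eq_sum_iff_of_le fun i _ => hhle i _ (hp i) (b k)).mp hsum i (Finset.mem_univ i)
    rw [← this]; exact hp i
  have hconf : Conf u h0 := ⟨hrecc, fun b j hj => (hε1 b j).2 hj, ⟨x0, fun j _ => (hε2 j).le⟩⟩
  refine ⟨F, inferInstance, inferInstance, u, h0, hh, hconf, ?_, ?_⟩
  · intro i b hb j hj
    rw [el_apply]
    linarith [hhle i _ (hBS b hb i) j]
  · intro σ T
    apply Set.Subset.antisymm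
    · intro y hy j _
      obtain ⟨g, hg, rfl⟩ := (Set.mem_finsetSum _ _ _).mp hy
      rw [dotProduct_sum, Finset.sum_apply]
      exact Finset.sum_le_sum fun i hi => hhle _ _ (hg hi) j
    · refine (hconf.K2 _).trans (convexHull_min ?_ (convex_sum _ fun i _ => convex_convexHull ℝ _))
      rintro _ ⟨b, hb, rfl⟩
      show xb u b _ ∈ _
      rw [map_sum]
      exact (Set.mem_finsetSum _ _ _).mpr ⟨fun i => xb u b (hh (σ i)), fun {i} hi => hBS b hb _, rfl⟩

end Poly

section Closed
variable {J : Type} [Fintype J] [DecidableEq J] {n : ℕ}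

lemma Conf.pos {u : J → Fin n → ℝ} {h0 : J → ℝ} (G : Conf u h0) :
    ∃ h' ∈ CC u h0, ∀ j, 0 < h' j := by
  obtain ⟨h, hh⟩ := G.good.ne
  obtain ⟨x, hx⟩ := G.good.exists_strict hh
  refine ⟨_, G.good.trans h hh (-x), fun j => ?_⟩
  rw [dotProduct_neg]; linarith [hx j (Finset.mem_univ j)]

lemma CK_add {u : J → Fin n → ℝ} {h0 h h' : J → ℝ} (hh : h ∈ CK u h0) (hh' : h' ∈ CC u h0) {ε : ℝ} (hε : 0 < ε) :
    h + ε • h' ∈ CC u h0 := by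
  intro b hb j hj
  rw [map_add, map_smul, smul_eq_mul]
  have := mul_pos hε (hh' b hb j hj)
  linarith [hh b hb j hj]

lemma Conf.vol_closed {u : J → Fin n → ℝ} {h0 : J → ℝ} (G : Conf u h0) {f} (hf : Rep u Finset.univ (CC u h0) f)
    {h} (hh : h ∈ CK u h0) : vol (P u Finset.univ h) = MvPolynomial.eval h f := by
  obtain ⟨h', hC, hpos⟩ := G.pos
  let e : ℕ → ℝ := fun k => 1 / ((k:ℝ) + 1)
  have he : Filter.Tendsto e Filter.atTop (nhds 0) := tendsto_one_div_add_atTop_nhds_zero_nat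
  have hep : ∀ k, 0 < e k := fun k => by positivity
  let s : ℕ → Set (Fin n → ℝ) := fun k => P u Finset.univ (h + e k • h')
  have hanti : Antitone s := by
    intro a b hab x hx j hj
    have h1 := hx j hj
    have h2 : e b ≤ e a := one_div_le_one_div_of_le (by positivity) (by gcongr)
    have h3 := mul_le_mul_of_nonneg_right h2 (hpos j).le
    simp only [Pi.add_apply, Pi.smul_apply, smul_eq_mul] at h1 ⊢
    linarith
  have hInter : ⋂ k, s k = P u Finset.univ h := by
    ext x
    rw [Set.mem_iInter]
    constructor
    · intro hx j hj
      have hlim : Filter.Tendsto (fun k => h j + e k * h' j) Filter.atTop (nhds (h j)) := by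
        have := (he.mul_const (h' j)).const_add (h j)
        simpa using this
      exact ge_of_tendsto' hlim fun k => hx k j hj
    · intro hx k j hj
      have h1 := hx j hj
      have := mul_pos (hep k) (hpos j)
      simp only [Pi.add_apply, Pi.smul_apply, smul_eq_mul]
      linarith
  have hfin : ∀ h, volume (P u Finset.univ h) ≠ ⊤ := fun h => (P_compact u _ G.recc h).measure_lt_top.ne
  have ht := tendsto_measure_iInter_atTop (μ := volume) (s := s)
    (fun k => (P_closed u _ _).measurableSet.nullMeasurableSet) hanti ⟨0, hfin _⟩
  rw [hInter] at ht
  have ht2 := (ENNReal.tendsto_toReal (hfin h)).comp ht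
  have hlim2 : Filter.Tendsto (fun k => MvPolynomial.eval (h + e k • h') f) Filter.atTop (nhds (MvPolynomial.eval h f)) := by
    have h1 : Filter.Tendsto (fun k => h + e k • h') Filter.atTop (nhds h) := by
      have := (he.smul_const h').const_add h
      simpa using this
    exact ((continuous_eval f).tendsto h).comp h1
  refine tendsto_nhds_unique (ht2.congr fun k => ?_) hlim2
  exact hf.2 _ (CK_add hh hC (hep k))

lemma CK_sum {u : J → Fin n → ℝ} {h0 : J → ℝ} {ι : Type} (T : Finset ι) (h : ι → J → ℝ) (hh : ∀ i, h i ∈ CK u h0) :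
    ∑ i ∈ T, h i ∈ CK u h0 := by
  intro b hb j hj
  rw [map_sum]
  exact Finset.sum_nonneg fun i _ => hh i b hb j hj

end Closed

lemma MV_eq {n : ℕ} (hn : 0 < n) (K : Fin n → Set (Fin n → ℝ)) :
    MV n K = ∑ S : Finset (Fin n), (-1:ℝ)^(n - S.card) * vol (∑ i ∈ S, K i) := by
  have h1 := Finset.sum_powerset (Finset.univ : Finset (Fin n)) (fun S => (-1:ℝ)^(n - S.card) * vol (∑ i ∈ S, K i))
  rw [Finset.powerset_univ] at h1
  rw [h1, Finset.card_univ, Fintype.card_fin, MV]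
  have h2 : Finset.range (n+1) = insert 0 (Finset.Icc 1 n) := by ext; simp; omega
  rw [h2, Finset.sum_insert (by simp)]
  haveI : Nonempty (Fin n) := ⟨⟨0, hn⟩⟩
  have h3 : vol (0 : Set (Fin n → ℝ)) = 0 := by
    have : volume ({0} : Set (Fin n → ℝ)) = 0 := measure_singleton _
    rw [vol, ← Set.singleton_zero, this]; rfl
  simp only [Finset.powersetCard_zero, Finset.sum_singleton, Finset.sum_empty, h3, mul_zero, zero_add]
  refine Finset.sum_congr rfl fun j hj => ?_
  rw [Finset.mul_sum]
  refine Finset.sum_congr rfl fun S hS => ?_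
  rw [(Finset.mem_powersetCard.mp hS).2]

theorem af_poly (m : ℕ) (X : Fin (m+2) → Set (Fin (m+2) → ℝ)) (hX : ∀ i, (X i).Finite) (hne : ∀ i, (X i).Nonempty)
    {x0 : Fin (m+2) → ℝ} (hx0 : x0 ∈ interior (∑ i, convexHull ℝ (X i))) (Q : Fin (m+2) → Set (Fin (m+2) → ℝ))
    (hQ : Q = fun i => convexHull ℝ (X i)) :
    MV (m+2) (fun i => Q ((Function.update id 1 0 : Fin (m+2) → Fin (m+2)) i)) *
      MV (m+2) (fun i => Q ((Function.update id 0 1 : Fin (m+2) → Fin (m+2)) i)) ≤ MV (m+2) (fun i => Q (id i)) ^ 2 := by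
  obtain ⟨J, _, _, u, h0, hh, G, hCK, hsum⟩ := exists_conf X hX hne hx0
  obtain ⟨f, hf⟩ := exists_rep G.good
  obtain ⟨h', hC, hpos⟩ := G.pos
  have hMV : ∀ σ : Fin (m+2) → Fin (m+2), MV (m+2) (fun i => Q (σ i)) =
      M (List.ofFn fun i => hh (σ i)) f := by
    intro σ
    rw [MV_eq (by omega), ← polarize f hf.1, hQ]
    refine Finset.sum_congr rfl fun S _ => ?_
    rw [hsum σ S, G.vol_closed hf (CK_sum _ _ fun i => hCK _)]
  have hcont : ∀ σ : Fin (m+2) → Fin (m+2),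
      Filter.Tendsto (fun ε : ℝ => M (List.ofFn fun i => hh (σ i) + ε • h') f) (nhdsWithin 0 (Set.Ioi 0))
        (nhds (MV (m+2) (fun i => Q (σ i)))) := by
    intro σ
    have h1 : Continuous (fun ε : ℝ => M (List.ofFn fun i => hh (σ i) + ε • h') f) := by
      simp only [← polarize f hf.1]
      refine continuous_finset_sum _ fun S _ => continuous_const.mul ((continuous_eval f).comp ?_)
      fun_prop
    have h2 := (h1.tendsto 0).mono_left (nhdsWithin_le_nhds (s := Set.Ioi 0))
    simp only [zero_smul, add_zero] at h2
    rw [hMV]; exact h2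
  refine le_of_tendsto_of_tendsto ((hcont _).mul (hcont _)) ((hcont id).pow 2) ?_
  filter_upwards [self_mem_nhdsWithin] with ε hε
  have hH : ∀ i, hh i + ε • h' ∈ CC u h0 := fun i => CK_add (hCK i) hC hε
  have := af_good m G.good hf (hh 0 + ε • h') (hh 1 + ε • h') (hH 1)
    (List.ofFn fun i : Fin m => hh i.succ.succ + ε • h') (by simp) (by
      intro h hm
      obtain ⟨i, rfl⟩ := (List.mem_ofFn' _ _).mp hm
      exact hH _)
  have e1 : ∀ i : Fin m, (Function.update id 1 0 : Fin (m+2) → Fin (m+2)) i.succ.succ = i.succ.succ := by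
    intro i
    rw [Function.update_of_ne]; rfl
    intro e; have := congrArg Fin.val e; simp at this
  have e2 : ∀ i : Fin m, (Function.update id 0 1 : Fin (m+2) → Fin (m+2)) i.succ.succ = i.succ.succ := by
    intro i
    rw [Function.update_of_ne]; rfl
    intro e; have := congrArg Fin.val e; simp at this
  simpa [List.ofFn_succ, e1, e2] using this

end AF



namespace AF

section Approx
variable {n : ℕ}

lemma approx {K : Set (Fin n → ℝ)} (hne : K.Nonempty) (hc : IsCompact K) (hcv : Convex ℝ K) {ε : ℝ} (hε : 0 < ε) :
    ∃ X : Set (Fin n → ℝ), X.Finite ∧ X.Nonempty ∧ K ⊆ convexHull ℝ X ∧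
      (∀ x ∈ convexHull ℝ X, ∃ y ∈ K, ‖x - y‖ ≤ ε) ∧ (interior (convexHull ℝ X)).Nonempty := by
  obtain ⟨t, htK, htf, hcov⟩ := hc.finite_cover_balls hε
  set V : Set (Fin n → ℝ) := Set.univ.pi fun _ => {-ε, ε} with hV
  have hVf : V.Finite := Set.Finite.pi' (fun _ => Set.toFinite _) |>.subset (by intro x hx i; exact hx i trivial)
  have hVc : convexHull ℝ V = Metric.closedBall 0 ε := by
    rw [hV, convexHull_pi]
    ext x
    simp only [Set.mem_pi, Set.mem_univ, true_imp_iff, convexHull_pair, Function.comp_def, mem_closedBall_zero_iff,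
      pi_norm_le_iff_of_nonneg hε.le, segment_eq_Icc (show -ε ≤ ε by linarith), Set.mem_Icc, Real.norm_eq_abs, abs_le]
  have hX : convexHull ℝ (t + V) = convexHull ℝ t + Metric.closedBall 0 ε := by rw [convexHull_add, hVc]
  have htne : t.Nonempty := by
    obtain ⟨x, hx⟩ := hne
    have := hcov hx
    simp only [Set.mem_iUnion] at this
    obtain ⟨y, hy, -⟩ := this
    exact ⟨y, hy⟩
  have hVne : V.Nonempty := ⟨fun _ => ε, fun i _ => by simp⟩
  refine ⟨t + V, htf.add hVf, htne.add hVne, ?_, ?_, ?_⟩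
  · rw [hX]
    intro x hx
    have := hcov hx
    simp only [Set.mem_iUnion] at this
    obtain ⟨y, hy, hxy⟩ := this
    refine ⟨y, subset_convexHull ℝ t hy, x - y, ?_, by simp⟩
    rw [mem_closedBall_zero_iff, ← dist_eq_norm]
    exact (Metric.mem_ball.mp hxy).le
  · rw [hX]
    rintro _ ⟨y, hy, e, he, rfl⟩
    refine ⟨y, convexHull_min htK hcv hy, ?_⟩
    simpa using he
  · rw [hX]
    obtain ⟨y, hy⟩ := htne
    refine ⟨y + 0, subset_interior_add_right ⟨y, subset_convexHull ℝ t hy, 0, ?_, rfl⟩⟩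
    exact Metric.ball_subset_interior_closedBall (Metric.mem_ball_self hε)

lemma compact_sum {ι : Type} (T : Finset ι) (K : ι → Set (Fin n → ℝ)) (hK : ∀ i, IsCompact (K i)) :
    IsCompact (∑ i ∈ T, K i) := by
  classical
  induction T using Finset.induction_on with
  | empty => simp only [Finset.sum_empty]; exact isCompact_singleton
  | insert a s ha ih => rw [Finset.sum_insert ha]; exact (hK a).add ih

lemma vol_lim {ι : Type} (T : Finset ι) (K : ι → Set (Fin n → ℝ)) (hK : ∀ i, IsCompact (K i))
    (e : ℕ → ℝ) (he : Filter.Tendsto e Filter.atTop (nhds 0)) (Q : ℕ → ι → Set (Fin n → ℝ))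
    (hKQ : ∀ k i, K i ⊆ Q k i) (hQK : ∀ k i, ∀ x ∈ Q k i, ∃ y ∈ K i, ‖x - y‖ ≤ e k) :
    Filter.Tendsto (fun k => vol (∑ i ∈ T, Q k i)) Filter.atTop (nhds (vol (∑ i ∈ T, K i))) := by
  have hc := compact_sum T K hK
  refine (ENNReal.tendsto_toReal hc.measure_lt_top.ne).comp ?_
  have he2 : Filter.Tendsto (fun k => T.card * e k) Filter.atTop (nhds 0) := by
    simpa using he.const_mul (T.card : ℝ)
  refine tendsto_of_tendsto_of_tendsto_of_le_of_le tendsto_const_nhds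
    ((tendsto_measure_cthickening_of_isCompact hc).comp he2) ?_ ?_
  · intro k
    exact measure_mono (Set.finsetSum_subset_finsetSum T _ _ fun i _ => hKQ k i)
  · intro k
    refine measure_mono fun x hx => ?_
    obtain ⟨g, hg, rfl⟩ := (Set.mem_finsetSum _ _ _).mp hx
    have : ∀ i, ∃ y, i ∈ T → y ∈ K i ∧ ‖g i - y‖ ≤ e k := by
      intro i
      by_cases hi : i ∈ T
      · obtain ⟨y, hy, h⟩ := hQK k i _ (hg hi)
        exact ⟨y, fun _ => ⟨hy, h⟩⟩
      · exact ⟨0, fun h => absurd h hi⟩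
    choose y hy using this
    refine Metric.mem_cthickening_of_dist_le _ (∑ i ∈ T, y i) _ _ ?_ ?_
    · exact (Set.mem_finsetSum _ _ _).mpr ⟨y, fun {i} hi => (hy i hi).1, rfl⟩
    · rw [dist_eq_norm, ← Finset.sum_sub_distrib]
      refine (norm_sum_le _ _).trans ((Finset.sum_le_card_nsmul _ _ (e k) fun i hi => (hy i hi).2).trans ?_)
      simp

end Approx

theorem af_main (m : ℕ) (K : Fin (m+2) → Set (Fin (m+2) → ℝ))
    (hne : ∀ i, (K i).Nonempty) (hcpt : ∀ i, IsCompact (K i)) (hconv : ∀ i, Convex ℝ (K i)) :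
    MV (m+2) (fun i => K ((Function.update id 1 0 : Fin (m+2) → Fin (m+2)) i)) *
      MV (m+2) (fun i => K ((Function.update id 0 1 : Fin (m+2) → Fin (m+2)) i)) ≤ MV (m+2) (fun i => K (id i)) ^ 2 := by
  let e : ℕ → ℝ := fun k => 1 / ((k:ℝ) + 1)
  have he : Filter.Tendsto e Filter.atTop (nhds 0) := tendsto_one_div_add_atTop_nhds_zero_nat
  have hep : ∀ k, 0 < e k := fun k => by positivity
  choose X hXf hXne hKX hXK hXi using fun k i => approx (hne i) (hcpt i) (hconv i) (hep k)
  let Q : ℕ → Fin (m+2) → Set (Fin (m+2) → ℝ) := fun k i => convexHull ℝ (X k i)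
  have hlim : ∀ σ : Fin (m+2) → Fin (m+2), Filter.Tendsto (fun k => MV (m+2) (fun i => Q k (σ i))) Filter.atTop
      (nhds (MV (m+2) (fun i => K (σ i)))) := by
    intro σ
    simp only [MV_eq (show 0 < m + 2 by omega)]
    refine tendsto_finset_sum _ fun S _ => Filter.Tendsto.const_mul _ ?_
    exact vol_lim S (fun i => K (σ i)) (fun i => hcpt _) e he (fun k i => Q k (σ i)) (fun k i => hKX k _)
      (fun k i => hXK k _)
  refine le_of_tendsto_of_tendsto' ((hlim _).mul (hlim _)) ((hlim id).pow 2) fun k => ?_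
  have hint : ∃ x0, x0 ∈ interior (∑ i, convexHull ℝ (X k i)) := by
    rw [Fin.sum_univ_succ]
    obtain ⟨x, hx⟩ := hXi k 0
    choose y hy using hXne k
    refine ⟨x + ∑ i : Fin (m+1), y i.succ, subset_interior_add_left ⟨x, hx, _, ?_, rfl⟩⟩
    exact (Set.mem_fintype_sum _ _).mpr ⟨_, fun i => subset_convexHull ℝ _ (hy _), rfl⟩
  obtain ⟨x0, hx0⟩ := hint
  exact af_poly m (X k) (hXf k) (hXne k) hx0 (Q k) rfl

end AF

theorem alexandrov_fenchel {n : ℕ} (hn : 2 ≤ n) (K : Fin n → Set (Fin n → ℝ))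
    (hne : ∀ i, (K i).Nonempty) (hcpt : ∀ i, IsCompact (K i))
    (hconv : ∀ i, Convex ℝ (K i)) :
    MV n K ^ 2 ≥
      MV n (Function.update K ⟨1, by omega⟩ (K ⟨0, by omega⟩)) *
        MV n (Function.update K ⟨0, by omega⟩ (K ⟨1, by omega⟩)) := by
  obtain ⟨m, rfl⟩ := Nat.exists_eq_add_of_le' hn
  have h := AF.af_main m K hne hcpt hconv
  have e1 : (fun i => K ((Function.update id 1 0 : Fin (m+2) → Fin (m+2)) i)) = Function.update K 1 (K 0) := by
    have := Function.comp_update K (id : Fin (m+2) → Fin (m+2)) 1 0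
    exact this
  have e2 : (fun i => K ((Function.update id 0 1 : Fin (m+2) → Fin (m+2)) i)) = Function.update K 0 (K 1) := by
    have := Function.comp_update K (id : Fin (m+2) → Fin (m+2)) 0 1
    exact this
  rw [e1, e2] at h
  exact h
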